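/- arXiv:2209.12869 — 6 statements merged into one kernel-verified Lean document; each statement's English description precedes it below -/
import Mathlib

section
/- For any edit path P from a geometric graph G to a geometric graph H in ℝ^d, Cost(P) ≥ Σ_{u∈V^G, P(u)≠ε_V} C_V·|u−P(u)| + Σ_{e∈E^G, P(e)≠ε_E} C_E·||e|−|P(e)|| + Σ_{e∈E^G, P(e)=ε_E} C_E·|e| + Σ_{f∈E^H, P^{-1}(f)=ε_E} C_E·|f|, where P^{-1} is the inverse edit path from H to G obtained by reversing each operation of P. -/
open scoped Classical
noncomputable section

/-- Points of the ambient Euclidean space `ℝ^d`. -/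
abbrev Pt (d : ℕ) := EuclideanSpace ℝ (Fin d)

/-- A combinatorial graph embedded in `ℝ^d`: a finite vertex set of points together with a
finite set of (oriented representatives of) straight-line edges, recorded as pairs of points. -/
structure EGraph (d : ℕ) where
  verts : Finset (Pt d)
  edges : Finset (Pt d × Pt d)

/-- A geometric graph of `ℝ^d`: the straight-line segments realizing the edges intersect
(possibly) only at shared endpoints. -/
structure GeoGraph (d : ℕ) extends EGraph d where
  edge_fst_mem : ∀ e ∈ edges, e.1 ∈ verts
  edge_snd_mem : ∀ e ∈ edges, e.2 ∈ verts
  edge_ne : ∀ e ∈ edges, e.1 ≠ e.2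
  segments_meet_at_endpoints : ∀ e ∈ edges, ∀ f ∈ edges, e ≠ f →
    ∀ p ∈ segment ℝ e.1 e.2 ∩ segment ℝ f.1 f.2,
      (p = e.1 ∨ p = e.2) ∧ (p = f.1 ∨ p = f.2)

/-- `Vol G`: the total edge length of `G`. -/
def EGraph.vol {d : ℕ} (G : EGraph d) : ℝ := ∑ e ∈ G.edges, dist e.1 e.2

/-- The degree of a vertex `u`: the number of edges incident to `u`. -/
def EGraph.degree {d : ℕ} (G : EGraph d) (u : Pt d) : ℕ :=
  (G.edges.filter (fun e => e.1 = u ∨ e.2 = u)).card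

/-- The maximum vertex degree of a graph. -/
def EGraph.maxDegree {d : ℕ} (G : EGraph d) : ℕ := G.verts.sup G.degree

/-- A graph has no isolated vertex when every vertex has an incident edge. -/
def NoIsolated {d : ℕ} (G : EGraph d) : Prop :=
  ∀ u ∈ G.verts, ∃ e ∈ G.edges, e.1 = u ∨ e.2 = u

/-- A state during an editing process: an abstract (labelled) combinatorial graph together
with an embedding of its vertices into `ℝ^d`.  Intermediate states need not be geometric
graphs (positions may even coincide). -/
structure EState (d : ℕ) where
  verts : Finset ℕ
  pos : ℕ → Pt d
  edges : Finset (ℕ × ℕ)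

/-- A state represents a geometric graph when its embedded image is exactly that graph. -/
def EState.Represents {d : ℕ} (S : EState d) (G : EGraph d) : Prop :=
  Set.InjOn S.pos ↑S.verts ∧
  S.verts.image S.pos = G.verts ∧
  (∀ e ∈ S.edges, e.1 ∈ S.verts ∧ e.2 ∈ S.verts) ∧
  S.edges.image (fun e => (S.pos e.1, S.pos e.2)) = G.edges

/-- The elementary edit operations. -/
inductive EditOp (d : ℕ) where
  | delVert (i : ℕ)
  | insVert (i : ℕ) (p : Pt d)
  | delEdge (i j : ℕ)
  | insEdge (i j : ℕ)
  | moveVert (i : ℕ) (p : Pt d)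

namespace EditOp

/-- The effect of an edit operation on a state. -/
def apply {d : ℕ} (S : EState d) : EditOp d → EState d
  | delVert i => ⟨S.verts.erase i, S.pos, S.edges⟩
  | insVert i p => ⟨insert i S.verts, Function.update S.pos i p, S.edges⟩
  | delEdge i j => ⟨S.verts, S.pos, S.edges.erase (i, j)⟩
  | insEdge i j => ⟨S.verts, S.pos, insert (i, j) S.edges⟩
  | moveVert i p => ⟨S.verts, Function.update S.pos i p, S.edges⟩

/-- Legality of an edit operation on a state: only isolated existing vertices may be deleted,
inserted vertices are new, deleted edges exist, and inserted edges join existing vertices. -/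
def legal {d : ℕ} (S : EState d) : EditOp d → Prop
  | delVert i => i ∈ S.verts ∧ ∀ e ∈ S.edges, e.1 ≠ i ∧ e.2 ≠ i
  | insVert i _ => i ∉ S.verts
  | delEdge i j => (i, j) ∈ S.edges
  | insEdge i j => i ∈ S.verts ∧ j ∈ S.verts ∧ (i, j) ∉ S.edges
  | moveVert i _ => i ∈ S.verts

/-- The cost of an edit operation: vertex insertion/deletion is free, edge insertion/deletion
costs `C_E` times the edge length, and translating a vertex costs `C_V` times the displacement
plus `C_E` times the total change in length of all incident edges. -/
def cost {d : ℕ} (CV CE : ℝ) (S : EState d) : EditOp d → ℝ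
  | delVert _ => 0
  | insVert _ _ => 0
  | delEdge i j => CE * dist (S.pos i) (S.pos j)
  | insEdge i j => CE * dist (S.pos i) (S.pos j)
  | moveVert i p => CV * dist (S.pos i) p +
      ∑ e ∈ S.edges,
        CE * |dist (Function.update S.pos i p e.1) (Function.update S.pos i p e.2)
                - dist (S.pos e.1) (S.pos e.2)|

/-- The inverse of an edit operation (relative to the state it is applied to). -/
def inv {d : ℕ} (S : EState d) : EditOp d → EditOp d
  | delVert i => insVert i (S.pos i)
  | insVert i _ => delVert i
  | delEdge i j => insEdge i j
  | insEdge i j => delEdge i j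
  | moveVert i _ => moveVert i (S.pos i)

end EditOp

/-- Applying a sequence of edit operations. -/
def applyPath {d : ℕ} (S : EState d) (P : List (EditOp d)) : EState d :=
  P.foldl EditOp.apply S

/-- Every operation of the sequence is legal on the intermediate result it is applied to. -/
def legalPath {d : ℕ} : EState d → List (EditOp d) → Prop
  | _, [] => True
  | S, o :: P => EditOp.legal S o ∧ legalPath (EditOp.apply S o) P

/-- The cost of an edit path: the sum of the costs of its individual edits. -/
def pathCost {d : ℕ} (CV CE : ℝ) : EState d → List (EditOp d) → ℝ
  | _, [] => 0
  | S, o :: P => EditOp.cost CV CE S o + pathCost CV CE (EditOp.apply S o) P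

/-- The inverse edit path: the reversed sequence of the inverse operations. -/
def invPath {d : ℕ} : EState d → List (EditOp d) → List (EditOp d)
  | _, [] => []
  | S, o :: P => invPath (EditOp.apply S o) P ++ [EditOp.inv S o]

/-- `P` is an edit path from `G` to `H`, starting at the representing state `S`. -/
def IsEditPathFrom {d : ℕ} (G H : EGraph d) (S : EState d) (P : List (EditOp d)) : Prop :=
  S.Represents G ∧ legalPath S P ∧ (applyPath S P).Represents H

/-- The geometric edit distance: the infimum cost of an edit path from `G` to `H`. -/
def GED {d : ℕ} (CV CE : ℝ) (G H : GeoGraph d) : ℝ :=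
  sInf {c : ℝ | ∃ (S : EState d) (P : List (EditOp d)),
    IsEditPathFrom G.toEGraph H.toEGraph S P ∧ pathCost CV CE S P = c}

/-- Distance between possibly-dummy vertices: `|a − ε_V| = 0`. -/
def odist {d : ℕ} : Option (Pt d) → Option (Pt d) → ℝ
  | some a, some b => dist a b
  | _, _ => 0

/-- Length of a possibly-dummy edge: `|ε_E| = 0`. -/
def elen {d : ℕ} : Option (Pt d × Pt d) → ℝ
  | some e => dist e.1 e.2
  | none => 0

/-- One step of the evolution of the vertex with label `i` under an edit operation;
a deleted vertex is recorded as the dummy vertex `none` and stays dummy. -/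
def vStep {d : ℕ} (i : ℕ) (o : EditOp d) (s : Option (Pt d)) : Option (Pt d) :=
  match s, o with
  | none, _ => none
  | some _, .delVert j => if j = i then none else s
  | some _, .moveVert j p => if j = i then some p else s
  | some _, _ => s

/-- The end result `P(u)` of the evolution of the vertex with label `i` under the path `P`. -/
def vTrack {d : ℕ} (i : ℕ) (P : List (EditOp d)) (s : Option (Pt d)) : Option (Pt d) :=
  P.foldl (fun s o => vStep i o s) s

/-- The cost of the orbit of the vertex with label `i`:
`C_V` times the total displacement along the orbit. -/
def vOrbitCost {d : ℕ} (CV : ℝ) (i : ℕ) : Option (Pt d) → List (EditOp d) → ℝ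
  | _, [] => 0
  | s, o :: P => CV * odist s (vStep i o s) + vOrbitCost CV i (vStep i o s) P

/-- One step of the evolution of the edge with label pair `(i, j)` under an edit operation;
a deleted edge (or an edge losing an endpoint) is recorded as the dummy edge `none`. -/
def eStep {d : ℕ} (i j : ℕ) (o : EditOp d) (s : Option (Pt d × Pt d)) :
    Option (Pt d × Pt d) :=
  match s, o with
  | none, _ => none
  | some _, .delEdge a b => if a = i ∧ b = j then none else s
  | some _, .delVert a => if a = i ∨ a = j then none else s
  | some q, .moveVert a p =>
      if a = i then some (p, q.2) else if a = j then some (q.1, p) else s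
  | some _, _ => s

/-- The end result `P(e)` of the evolution of the edge with label pair `(i, j)` under `P`. -/
def eTrack {d : ℕ} (i j : ℕ) (P : List (EditOp d)) (s : Option (Pt d × Pt d)) :
    Option (Pt d × Pt d) :=
  P.foldl (fun s o => eStep i j o s) s

/-- The cost of the orbit of the edge with label pair `(i, j)`:
`C_E` times the total variation of its length along the orbit. -/
def eOrbitCost {d : ℕ} (CE : ℝ) (i j : ℕ) : Option (Pt d × Pt d) → List (EditOp d) → ℝ
  | _, [] => 0
  | s, o :: P => CE * |elen (eStep i j o s) - elen s| + eOrbitCost CE i j (eStep i j o s) P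

/-- An inexact matching between `G` and `H`: every vertex of `G` is matched with exactly one
vertex of `H` or with the dummy vertex (`none`), and conversely, consistently. -/
structure Matching (d : ℕ) (G H : EGraph d) where
  f : Pt d → Option (Pt d)
  g : Pt d → Option (Pt d)
  f_mem : ∀ u ∈ G.verts, ∀ v, f u = some v → v ∈ H.verts
  g_mem : ∀ v ∈ H.verts, ∀ u, g v = some u → u ∈ G.verts
  consistent : ∀ u ∈ G.verts, ∀ v ∈ H.verts, (f u = some v ↔ g v = some u)

/-- The image `π(e) = (π(u₁), π(u₂))` of an edge under a matching: it is the dummy edge `none`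
if either endpoint is matched with the dummy vertex, or if the image is not an edge of the
target graph `T`. -/
def mEdge {d : ℕ} (T : EGraph d) (φ : Pt d → Option (Pt d)) (e : Pt d × Pt d) :
    Option (Pt d × Pt d) :=
  match φ e.1, φ e.2 with
  | some a, some b => if (a, b) ∈ T.edges then some (a, b) else none
  | _, _ => none

/-- The cost of an inexact matching: vertex translations, edge translations, and deletions of
the unmatched edges from both graphs. -/
def matchCost {d : ℕ} (CV CE : ℝ) {G H : EGraph d} (m : Matching d G H) : ℝ :=
  (∑ u ∈ G.verts.filter (fun u => m.f u ≠ none), CV * odist (some u) (m.f u)) +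
  (∑ e ∈ G.edges.filter (fun e => mEdge H m.f e ≠ none),
      CE * |dist e.1 e.2 - elen (mEdge H m.f e)|) +
  (∑ e ∈ G.edges.filter (fun e => mEdge H m.f e = none), CE * dist e.1 e.2) +
  (∑ f ∈ H.edges.filter (fun f => mEdge G m.g f = none), CE * dist f.1 f.2)

/-- The geometric graph distance: the minimum cost of an inexact matching. -/
def GGD {d : ℕ} (CV CE : ℝ) (G H : GeoGraph d) : ℝ :=
  sInf {c : ℝ | ∃ m : Matching d G.toEGraph H.toEGraph, matchCost CV CE m = c}

/-- The point `(a, b)` of `ℝ²`. -/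
def pt2 (a b : ℝ) : Pt 2 := (WithLp.equiv 2 (Fin 2 → ℝ)).symm ![a, b]

/-- The point `a` of `ℝ¹`. -/
def pt1 (a : ℝ) : Pt 1 := (WithLp.equiv 2 (Fin 1 → ℝ)).symm ![a]

/-- Every edge has its endpoints among the vertices. -/
def VS {d : ℕ} (S : EState d) : Prop := ∀ e ∈ S.edges, e.1 ∈ S.verts ∧ e.2 ∈ S.verts

/-- Length of the labelled edge `e` in the state `S`, zero if it is absent. -/
def ell {d : ℕ} (S : EState d) (e : ℕ × ℕ) : ℝ :=
  if e ∈ S.edges then dist (S.pos e.1) (S.pos e.2) else 0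

/-- Displacement of vertex `i` by one operation. -/
def vc {d : ℕ} (S : EState d) (i : ℕ) : EditOp d → ℝ
  | .moveVert j p => if j = i then dist (S.pos i) p else 0
  | _ => 0

/-- Total displacement of the vertex label `i`. -/
def tvV {d : ℕ} (i : ℕ) : EState d → List (EditOp d) → ℝ
  | _, [] => 0
  | S, o :: P => vc S i o + tvV i (EditOp.apply S o) P

/-- Total variation of the length of the edge label `e`. -/
def tvE {d : ℕ} (e : ℕ × ℕ) : EState d → List (EditOp d) → ℝ
  | _, [] => 0
  | S, o :: P => |ell (EditOp.apply S o) e - ell S e| + tvE e (EditOp.apply S o) P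

/-- The edge label `e` is present in all states along the path. -/
def surv {d : ℕ} (e : ℕ × ℕ) : EState d → List (EditOp d) → Prop
  | S, [] => e ∈ S.edges
  | S, o :: P => e ∈ S.edges ∧ surv e (EditOp.apply S o) P

theorem VS_apply {d : ℕ} {S : EState d} (hS : VS S) {o : EditOp d} (ho : EditOp.legal S o) :
    VS (EditOp.apply S o) := by
  intro e he
  cases o with
  | delVert i =>
    have h1 := hS e he
    have h2 := ho.2 e he
    simp only [EditOp.apply, Finset.mem_erase]
    exact ⟨⟨h2.1, h1.1⟩, ⟨h2.2, h1.2⟩⟩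
  | insVert i p =>
    have h1 := hS e he
    simp only [EditOp.apply, Finset.mem_insert]
    exact ⟨Or.inr h1.1, Or.inr h1.2⟩
  | delEdge i j => exact hS e (Finset.mem_of_mem_erase he)
  | insEdge i j =>
    simp only [EditOp.apply, Finset.mem_insert] at he
    rcases he with rfl | he
    · exact ⟨ho.1, ho.2.1⟩
    · exact hS e he
  | moveVert i p => exact hS e he

theorem surv_mem {d : ℕ} {e : ℕ × ℕ} {S : EState d} {P : List (EditOp d)} (h : surv e S P) :
    e ∈ S.edges := by
  cases P with
  | nil => exact h
  | cons o P => exact h.1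

theorem ell_nonneg {d : ℕ} (S : EState d) (e : ℕ × ℕ) : 0 ≤ ell S e := by
  unfold ell; split_ifs <;> positivity

theorem tvE_tri {d : ℕ} (e : ℕ × ℕ) (P : List (EditOp d)) : ∀ S : EState d,
    |ell S e - ell (applyPath S P) e| ≤ tvE e S P := by
  induction P with
  | nil => intro S; simp [applyPath, tvE]
  | cons o P ih =>
    intro S
    have h := ih (EditOp.apply S o)
    have h2 := abs_sub_le (ell S e) (ell (EditOp.apply S o) e) (ell (applyPath S (o :: P)) e)
    rw [abs_sub_comm (ell S e) (ell (EditOp.apply S o) e)] at h2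
    change _ ≤ |ell (EditOp.apply S o) e - ell S e| + tvE e (EditOp.apply S o) P
    exact h2.trans (by gcongr; exact h)

theorem tvE_dead {d : ℕ} (e : ℕ × ℕ) (P : List (EditOp d)) : ∀ S : EState d,
    ¬ surv e S P → ell S e + ell (applyPath S P) e ≤ tvE e S P := by
  induction P with
  | nil => intro S h; have : e ∉ S.edges := h; simp [applyPath, tvE, ell, this]
  | cons o P ih =>
    intro S h
    by_cases he : e ∈ S.edges
    · have h' : ¬ surv e (EditOp.apply S o) P := fun hs => h ⟨he, hs⟩
      have h1 := ih _ h'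
      have h2 := neg_abs_le (ell (EditOp.apply S o) e - ell S e)
      change ell S e + ell (applyPath (EditOp.apply S o) P) e ≤
        |ell (EditOp.apply S o) e - ell S e| + tvE e (EditOp.apply S o) P
      linarith
    · have h0 : ell S e = 0 := by simp [ell, he]
      have h1 := tvE_tri e (o :: P) S
      rw [h0, zero_sub, abs_neg, abs_of_nonneg (ell_nonneg _ _)] at h1
      rw [h0, zero_add]; exact h1

theorem eTrack_none {d : ℕ} (i j : ℕ) (P : List (EditOp d)) : eTrack i j P none = none := by
  induction P with
  | nil => rfl
  | cons o P ih => exact ih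

theorem vTrack_none {d : ℕ} (i : ℕ) (P : List (EditOp d)) : vTrack i P none = none := by
  induction P with
  | nil => rfl
  | cons o P ih => exact ih

theorem eStep_fwd {d : ℕ} {S : EState d} (hS : VS S) {o : EditOp d} (ho : EditOp.legal S o)
    {e : ℕ × ℕ} (hne : e.1 ≠ e.2) (he : e ∈ S.edges) :
    eStep e.1 e.2 o (some (S.pos e.1, S.pos e.2)) =
      if e ∈ (EditOp.apply S o).edges then
        some ((EditOp.apply S o).pos e.1, (EditOp.apply S o).pos e.2) else none := by
  have hv := hS e he
  obtain ⟨a, b⟩ := e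
  cases o with
  | delVert i =>
    have h2 := ho.2 _ he
    simp only at h2
    simp [eStep, EditOp.apply, he, h2.1.symm, h2.2.symm]
  | insVert i p =>
    have h1 : a ≠ i := by rintro rfl; exact ho hv.1
    have h2 : b ≠ i := by rintro rfl; exact ho hv.2
    simp [eStep, EditOp.apply, he, h1, h2]
  | delEdge i j =>
    by_cases h : i = a ∧ j = b
    · simp [eStep, EditOp.apply, h]
    · have : ¬ (a = i ∧ b = j) := fun h' => h ⟨h'.1.symm, h'.2.symm⟩
      simp only [eStep, EditOp.apply, h, if_false, Finset.mem_erase, Prod.mk.injEq, ne_eq, this,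
        not_false_eq_true, he, and_self, if_true]
  | insEdge i j => simp [eStep, EditOp.apply, he]
  | moveVert i p =>
    simp only at hne
    by_cases h1 : i = a
    · subst h1; simp [eStep, EditOp.apply, he, hne.symm]
    · by_cases h2 : i = b
      · subst h2; simp [eStep, EditOp.apply, he, hne, h1]
      · simp [eStep, EditOp.apply, he, h1, h2, Ne.symm h1, Ne.symm h2]

theorem eTrack_fwd {d : ℕ} {e : ℕ × ℕ} (hne : e.1 ≠ e.2) (P : List (EditOp d)) :
    ∀ S : EState d, VS S → legalPath S P → e ∈ S.edges →
    eTrack e.1 e.2 P (some (S.pos e.1, S.pos e.2)) =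
      if surv e S P then some ((applyPath S P).pos e.1, (applyPath S P).pos e.2) else none := by
  induction P with
  | nil => intro S _ _ he; simp [eTrack, surv, he, applyPath]
  | cons o P ih =>
    intro S hS hl he
    change eTrack e.1 e.2 P (eStep e.1 e.2 o _) = _
    rw [eStep_fwd hS hl.1 hne he]
    split_ifs with h1 h2 h2
    · rw [ih _ (VS_apply hS hl.1) hl.2 h1, if_pos h2.2]; rfl
    · rw [ih _ (VS_apply hS hl.1) hl.2 h1, if_neg (fun h => h2 ⟨he, h⟩)]
    · exact absurd (surv_mem h2.2) h1
    · exact eTrack_none _ _ _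

theorem eStep_bwd {d : ℕ} {S : EState d} (hS : VS S) {o : EditOp d} (ho : EditOp.legal S o)
    {e : ℕ × ℕ} (he : e ∈ (EditOp.apply S o).edges) (q : Pt d × Pt d) :
    eStep e.1 e.2 (EditOp.inv S o) (some q) = none ↔ e ∉ S.edges := by
  obtain ⟨a, b⟩ := e
  cases o with
  | delVert i =>
    have he' : (a, b) ∈ S.edges := he
    simp [eStep, EditOp.inv, he']
  | insVert i p =>
    have he' : (a, b) ∈ S.edges := he
    have hv := hS _ he'
    have h1 : i ≠ a := by rintro rfl; exact ho hv.1
    have h2 : i ≠ b := by rintro rfl; exact ho hv.2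
    simp [eStep, EditOp.inv, he', h1, h2]
  | delEdge i j =>
    have he' : (a, b) ∈ S.edges := Finset.mem_of_mem_erase he
    simp [eStep, EditOp.inv, he']
  | insEdge i j =>
    by_cases h : i = a ∧ j = b
    · obtain ⟨rfl, rfl⟩ := h
      simpa [eStep, EditOp.inv] using ho.2.2
    · have h' : ¬ (a = i ∧ b = j) := fun h' => h ⟨h'.1.symm, h'.2.symm⟩
      simp only [EditOp.apply, Finset.mem_insert, Prod.mk.injEq, h', false_or] at he
      simp only [eStep, EditOp.inv, h, if_false, he, not_true, reduceCtorEq]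
  | moveVert i p =>
    have he' : (a, b) ∈ S.edges := he
    simp only [eStep, EditOp.inv, he', not_true, iff_false]
    split_ifs <;> simp

theorem eTrack_bwd {d : ℕ} {e : ℕ × ℕ} (P : List (EditOp d)) :
    ∀ S : EState d, VS S → legalPath S P → e ∈ (applyPath S P).edges → ∀ q : Pt d × Pt d,
    (eTrack e.1 e.2 (invPath S P) (some q) = none ↔ ¬ surv e S P) := by
  induction P with
  | nil => intro S _ _ he q; have : e ∈ S.edges := he; simp [eTrack, surv, this, invPath]
  | cons o P ih =>
    intro S hS hl he q
    have h := ih _ (VS_apply hS hl.1) hl.2 he q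
    have hh : eTrack e.1 e.2 (invPath S (o :: P)) (some q) =
        eStep e.1 e.2 (EditOp.inv S o)
          (eTrack e.1 e.2 (invPath (EditOp.apply S o) P) (some q)) := by
      simp [eTrack, invPath, List.foldl_append]
    rw [hh]
    change _ ↔ ¬ (e ∈ S.edges ∧ surv e (EditOp.apply S o) P)
    by_cases hs : surv e (EditOp.apply S o) P
    · rcases hx : eTrack e.1 e.2 (invPath (EditOp.apply S o) P) (some q) with _ | r
      · exact absurd hs (h.1 hx)
      · rw [eStep_bwd hS hl.1 (surv_mem hs)]; tauto
    · rw [h.2 hs]; simp [eStep, hs]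

theorem vc_nonneg {d : ℕ} (S : EState d) (i : ℕ) (o : EditOp d) : 0 ≤ vc S i o := by
  cases o <;> simp only [vc, le_refl]
  split_ifs <;> positivity

theorem tvV_nonneg {d : ℕ} (i : ℕ) (P : List (EditOp d)) : ∀ S : EState d, 0 ≤ tvV i S P := by
  induction P with
  | nil => intro S; exact le_refl _
  | cons o P ih => intro S; exact add_nonneg (vc_nonneg _ _ _) (ih _)

theorem vStep_fwd {d : ℕ} {S : EState d} {o : EditOp d} (ho : EditOp.legal S o) {i : ℕ}
    (hi : i ∈ S.verts) :
    vStep i o (some (S.pos i)) = none ∨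
      (vStep i o (some (S.pos i)) = some ((EditOp.apply S o).pos i) ∧
        i ∈ (EditOp.apply S o).verts ∧ dist (S.pos i) ((EditOp.apply S o).pos i) ≤ vc S i o) := by
  cases o with
  | delVert j =>
    by_cases h : j = i
    · left; simp [vStep, h]
    · right; simp [vStep, EditOp.apply, h, hi, vc, Ne.symm h]
  | insVert j p =>
    have h : i ≠ j := by rintro rfl; exact ho hi
    right; simp [vStep, EditOp.apply, h, hi, vc]
  | delEdge a b => right; simp [vStep, EditOp.apply, hi, vc]
  | insEdge a b => right; simp [vStep, EditOp.apply, hi, vc]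
  | moveVert j p =>
    right
    by_cases h : j = i
    · subst h; simp [vStep, EditOp.apply, hi, vc]
    · simp [vStep, EditOp.apply, h, hi, vc, Ne.symm h]

theorem vTrack_le {d : ℕ} (i : ℕ) (P : List (EditOp d)) : ∀ S : EState d, legalPath S P →
    i ∈ S.verts → odist (some (S.pos i)) (vTrack i P (some (S.pos i))) ≤ tvV i S P := by
  induction P with
  | nil => intro S _ _; simp [vTrack, odist, tvV]
  | cons o P ih =>
    intro S hl hi
    change odist _ (vTrack i P (vStep i o _)) ≤ vc S i o + tvV i (EditOp.apply S o) P
    rcases vStep_fwd hl.1 hi with h | ⟨h, h1, h2⟩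
    · rw [h, vTrack_none]
      exact add_nonneg (vc_nonneg _ _ _) (tvV_nonneg _ _ _)
    · rw [h]
      have h3 := ih _ hl.2 h1
      rcases hx : vTrack i P (some ((EditOp.apply S o).pos i)) with _ | q
      · exact add_nonneg (vc_nonneg _ _ _) (tvV_nonneg _ _ _)
      · rw [hx] at h3
        simp only [odist] at h3 ⊢
        have := dist_triangle (S.pos i) ((EditOp.apply S o).pos i) q
        linarith

theorem sum_single_le {ι : Type*} (W : Finset ι) (f : ι → ℝ) (a : ι) (c : ℝ) (hc : 0 ≤ c)
    (ha : f a ≤ c) (h : ∀ x, x ≠ a → f x = 0) : ∑ x ∈ W, f x ≤ c := by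
  by_cases haW : a ∈ W
  · rw [Finset.sum_eq_single_of_mem a haW (fun b _ hb => h b hb)]; exact ha
  · rw [Finset.sum_eq_zero]
    · exact hc
    · intro x hx; exact h x (by rintro rfl; exact haW hx)

theorem cost_ge {d : ℕ} {CV CE : ℝ} (hCV : 0 < CV) (hCE : 0 < CE) {S : EState d} (hS : VS S)
    {o : EditOp d} (ho : EditOp.legal S o) (U : Finset ℕ) (W : Finset (ℕ × ℕ)) :
    CV * ∑ i ∈ U, vc S i o + CE * ∑ e ∈ W, |ell (EditOp.apply S o) e - ell S e| ≤
      EditOp.cost CV CE S o := by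
  cases o with
  | delVert i =>
    have : ∀ e, ell (EditOp.apply S (.delVert i)) e = ell S e := fun e => rfl
    simp [vc, this, EditOp.cost]
  | insVert i p =>
    have : ∀ e, ell (EditOp.apply S (.insVert i p)) e = ell S e := by
      intro e
      unfold ell
      by_cases he : e ∈ S.edges
      · have hv := hS e he
        have h1 : e.1 ≠ i := by intro h; exact ho (h ▸ hv.1)
        have h2 : e.2 ≠ i := by intro h; exact ho (h ▸ hv.2)
        simp [EditOp.apply, he, h1, h2]
      · simp [EditOp.apply, he]
    simp [vc, this, EditOp.cost]
  | delEdge i j =>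
    have hm : (i, j) ∈ S.edges := ho
    simp only [vc, Finset.sum_const_zero, mul_zero, zero_add, EditOp.cost]
    refine mul_le_mul_of_nonneg_left ?_ hCE.le
    refine sum_single_le W _ (i, j) _ dist_nonneg ?_ ?_
    · simp [ell, EditOp.apply, hm]
    · intro x hx; simp [ell, EditOp.apply, hx]
  | insEdge i j =>
    have hm : (i, j) ∉ S.edges := ho.2.2
    simp only [vc, Finset.sum_const_zero, mul_zero, zero_add, EditOp.cost]
    refine mul_le_mul_of_nonneg_left ?_ hCE.le
    refine sum_single_le W _ (i, j) _ dist_nonneg ?_ ?_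
    · simp [ell, EditOp.apply, hm]
    · intro x hx; simp [ell, EditOp.apply, hx]
  | moveVert i p =>
    simp only [EditOp.cost]
    rw [← Finset.mul_sum]
    refine add_le_add (mul_le_mul_of_nonneg_left ?_ hCV.le) (mul_le_mul_of_nonneg_left ?_ hCE.le)
    · refine sum_single_le U _ i _ dist_nonneg ?_ ?_
      · simp [vc]
      · intro x hx; simp [vc, hx.symm]
    · rw [← Finset.sum_filter_add_sum_filter_not W (fun e => e ∈ S.edges)]
      have h0 : ∑ e ∈ W.filter (fun e => e ∉ S.edges),
          |ell (EditOp.apply S (.moveVert i p)) e - ell S e| = 0 := by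
        refine Finset.sum_eq_zero fun e he => ?_
        have := (Finset.mem_filter.1 he).2
        simp [ell, EditOp.apply, this]
      rw [h0, add_zero]
      refine (Finset.sum_le_sum_of_subset_of_nonneg (t := S.edges)
        (fun e he => (Finset.mem_filter.1 he).2) (fun _ _ _ => abs_nonneg _)).trans ?_
      refine (Finset.sum_congr rfl fun e he => ?_).le
      simp [ell, EditOp.apply, he]

theorem pathCost_ge {d : ℕ} {CV CE : ℝ} (hCV : 0 < CV) (hCE : 0 < CE) (U : Finset ℕ)
    (W : Finset (ℕ × ℕ)) (P : List (EditOp d)) : ∀ S : EState d, VS S → legalPath S P →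
    CV * ∑ i ∈ U, tvV i S P + CE * ∑ e ∈ W, tvE e S P ≤ pathCost CV CE S P := by
  induction P with
  | nil => intro S _ _; simp [tvV, tvE, pathCost]
  | cons o P ih =>
    intro S hS hl
    have h1 := cost_ge hCV hCE hS hl.1 U W
    have h2 := ih _ (VS_apply hS hl.1) hl.2
    simp only [tvV, tvE, pathCost, Finset.sum_add_distrib]
    linarith

theorem represents_ne {d : ℕ} {G : GeoGraph d} {S : EState d} (h : S.Represents G.toEGraph)
    {e : ℕ × ℕ} (he : e ∈ S.edges) : e.1 ≠ e.2 := by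
  intro h'
  have hm : (S.pos e.1, S.pos e.2) ∈ G.edges := by
    rw [← h.2.2.2]; exact Finset.mem_image_of_mem (fun e => (S.pos e.1, S.pos e.2)) he
  exact G.edge_ne _ hm (by simp [h'])

theorem surv_last {d : ℕ} {e : ℕ × ℕ} {P : List (EditOp d)} : ∀ {S : EState d}, surv e S P →
    e ∈ (applyPath S P).edges := by
  induction P with
  | nil => intro S h; exact h
  | cons o P ih => intro S h; exact ih h.2

/-- For any edit path `P` from `G` to `H`,
`Cost(P) ≥ Σ_{u ∈ V^G, P(u) ≠ ε_V} C_V·|u − P(u)| + Σ_{e ∈ E^G, P(e) ≠ ε_E} C_E·||e| − |P(e)||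
  + Σ_{e ∈ E^G, P(e) = ε_E} C_E·|e| + Σ_{f ∈ E^H, P⁻¹(f) = ε_E} C_E·|f|`,
where `P⁻¹` is the inverse edit path from `H` to `G`. -/
theorem pathCost_lower_bound {d : ℕ} (CV CE : ℝ) (hCV : 0 < CV) (hCE : 0 < CE)
    (G H : GeoGraph d) (S : EState d) (P : List (EditOp d))
    (hP : IsEditPathFrom G.toEGraph H.toEGraph S P) :
    pathCost CV CE S P ≥
      (∑ i ∈ S.verts.filter (fun i => vTrack i P (some (S.pos i)) ≠ none),
        CV * odist (some (S.pos i)) (vTrack i P (some (S.pos i)))) +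
      (∑ e ∈ S.edges.filter
          (fun e => eTrack e.1 e.2 P (some (S.pos e.1, S.pos e.2)) ≠ none),
        CE * |dist (S.pos e.1) (S.pos e.2) -
                elen (eTrack e.1 e.2 P (some (S.pos e.1, S.pos e.2)))|) +
      (∑ e ∈ S.edges.filter
          (fun e => eTrack e.1 e.2 P (some (S.pos e.1, S.pos e.2)) = none),
        CE * dist (S.pos e.1) (S.pos e.2)) +
      (∑ f ∈ (applyPath S P).edges.filter (fun f =>
          eTrack f.1 f.2 (invPath S P)
            (some ((applyPath S P).pos f.1, (applyPath S P).pos f.2)) = none),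
        CE * dist ((applyPath S P).pos f.1) ((applyPath S P).pos f.2)) := by
  obtain ⟨hG, hl, hH⟩ := hP
  have hS : VS S := hG.2.2.1
  refine ge_iff_le.2 (le_trans ?_
    (pathCost_ge hCV hCE S.verts (S.edges ∪ (applyPath S P).edges) P S hS hl))
  have hV : (∑ i ∈ S.verts.filter (fun i => vTrack i P (some (S.pos i)) ≠ none),
        CV * odist (some (S.pos i)) (vTrack i P (some (S.pos i)))) ≤
      CV * ∑ i ∈ S.verts, tvV i S P := by
    rw [Finset.mul_sum]
    refine (Finset.sum_le_sum fun i hi => mul_le_mul_of_nonneg_left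
      (vTrack_le i P S hl (Finset.mem_filter.1 hi).1) hCV.le).trans ?_
    exact Finset.sum_le_sum_of_subset_of_nonneg (Finset.filter_subset _ _)
      (fun i _ _ => mul_nonneg hCV.le (tvV_nonneg _ _ _))
  rw [add_assoc, add_assoc]
  refine add_le_add hV ?_
  have ext_sum : ∀ (A : Finset (ℕ × ℕ)) (p : ℕ × ℕ → Prop) [DecidablePred p] (f : ℕ × ℕ → ℝ),
      A ⊆ S.edges ∪ (applyPath S P).edges →
      ∑ e ∈ A.filter p, f e =
        ∑ e ∈ S.edges ∪ (applyPath S P).edges, if e ∈ A ∧ p e then f e else 0 := by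
    intro A p _ f hA
    rw [← Finset.sum_filter]
    refine Finset.sum_congr ?_ fun _ _ => rfl
    ext e
    simp only [Finset.mem_filter]
    exact ⟨fun h => ⟨hA h.1, h⟩, fun h => h.2⟩
  rw [ext_sum S.edges _ _ Finset.subset_union_left,
    ext_sum S.edges _ _ Finset.subset_union_left,
    ext_sum (applyPath S P).edges _ _ Finset.subset_union_right,
    ← Finset.sum_add_distrib, ← Finset.sum_add_distrib, Finset.mul_sum]
  refine Finset.sum_le_sum fun e _ => ?_
  have hB : ∀ h : e ∈ (applyPath S P).edges, _ := fun h =>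
    eTrack_bwd P S hS hl h ((applyPath S P).pos e.1, (applyPath S P).pos e.2)
  have hF : ∀ h : e ∈ S.edges, _ := fun h => eTrack_fwd (represents_ne hG h) P S hS hl h
  have t1 := tvE_tri e P S
  by_cases hs : surv e S P
  · have he := surv_mem hs
    have hF' := hF he
    rw [if_pos hs] at hF'
    have h3 : ¬ (e ∈ (applyPath S P).edges ∧ eTrack e.1 e.2 (invPath S P)
      (some ((applyPath S P).pos e.1, (applyPath S P).pos e.2)) = none) :=
      fun h => (hB h.1).1 h.2 hs
    have hTm : e ∈ (applyPath S P).edges := surv_last hs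
    rw [if_neg h3, hF']
    simp only [ell, he, hTm, if_true] at t1
    simpa [he, elen] using mul_le_mul_of_nonneg_left t1 hCE.le
  · have t2 := mul_le_mul_of_nonneg_left (tvE_dead e P S hs) hCE.le
    refine le_trans ?_ t2
    rw [mul_add]
    have hb : (if e ∈ (applyPath S P).edges ∧ eTrack e.1 e.2 (invPath S P)
        (some ((applyPath S P).pos e.1, (applyPath S P).pos e.2)) = none then
        CE * dist ((applyPath S P).pos e.1) ((applyPath S P).pos e.2) else 0) ≤
        CE * ell (applyPath S P) e := by
      split_ifs with h
      · simp [ell, h.1]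
      · exact mul_nonneg hCE.le (ell_nonneg _ _)
    rw [← add_assoc]
    refine add_le_add ?_ hb
    by_cases he : e ∈ S.edges
    · have hF' := hF he
      rw [if_neg hs] at hF'
      rw [hF']
      simp [he, ell]
    · simp [he, ell]
end
end

section
/- Let G and H be geometric graphs in ℝ^d without isolated vertices. If GED(G,H) = 0 then G = H, i.e. V^G = V^H and E^G = E^H. -/
open scoped Classical
noncomputable section

/-- Every edge joins existing vertices. -/
def EState.WF {d : ℕ} (S : EState d) : Prop :=
  ∀ e ∈ S.edges, e.1 ∈ S.verts ∧ e.2 ∈ S.verts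

theorem WF_apply {d : ℕ} {S : EState d} {o : EditOp d} (hS : S.WF) (ho : EditOp.legal S o) :
    (EditOp.apply S o).WF := by
  intro e he
  cases o with
  | delVert i =>
    obtain ⟨h1, h2⟩ := ho
    simp only [EditOp.apply, Finset.mem_erase] at he ⊢
    exact ⟨⟨(h2 e he).1, (hS e he).1⟩, ⟨(h2 e he).2, (hS e he).2⟩⟩
  | insVert i p =>
    simp only [EditOp.apply, Finset.mem_insert] at he ⊢
    exact ⟨Or.inr (hS e he).1, Or.inr (hS e he).2⟩
  | delEdge i j =>
    simp only [EditOp.apply, Finset.mem_erase] at he ⊢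
    exact hS e he.2
  | insEdge i j =>
    obtain ⟨h1, h2, h3⟩ := ho
    simp only [EditOp.apply, Finset.mem_insert] at he ⊢
    rcases he with rfl | he
    · exact ⟨h1, h2⟩
    · exact hS e he
  | moveVert i p => exact hS e he

theorem cost_nonneg {d : ℕ} {CV CE : ℝ} (hCV : 0 < CV) (hCE : 0 < CE) (S : EState d)
    (o : EditOp d) : 0 ≤ EditOp.cost CV CE S o := by
  cases o <;> simp only [EditOp.cost] <;> try positivity

/-- The edge `(i, j)` is close in `S` and `T`, at cost `c`. -/
def Near {d : ℕ} (CV CE c : ℝ) (S T : EState d) (i j : ℕ) : Prop :=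
  CE * |dist (S.pos i) (S.pos j) - dist (T.pos i) (T.pos j)| ≤ c ∧
  CV * dist (S.pos i) (T.pos i) ≤ c ∧ CV * dist (S.pos j) (T.pos j) ≤ c

theorem near_of_eq {d : ℕ} {CV CE c : ℝ} {S T : EState d} {i j : ℕ} (hc : 0 ≤ c)
    (h1 : T.pos i = S.pos i) (h2 : T.pos j = S.pos j) : Near CV CE c S T i j := by
  simp [Near, h1, h2, hc]

theorem near_trans {d : ℕ} {CV CE c c' : ℝ} (hCV : 0 < CV) (hCE : 0 < CE)
    {S T U : EState d} {i j : ℕ} (h1 : Near CV CE c S T i j) (h2 : Near CV CE c' T U i j) :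
    Near CV CE (c + c') S U i j := by
  obtain ⟨a1, a2, a3⟩ := h1
  obtain ⟨b1, b2, b3⟩ := h2
  have t1 := mul_le_mul_of_nonneg_left (abs_sub_le (dist (S.pos i) (S.pos j))
    (dist (T.pos i) (T.pos j)) (dist (U.pos i) (U.pos j))) hCE.le
  have t2 := mul_le_mul_of_nonneg_left (dist_triangle (S.pos i) (T.pos i) (U.pos i)) hCV.le
  have t3 := mul_le_mul_of_nonneg_left (dist_triangle (S.pos j) (T.pos j) (U.pos j)) hCV.le
  exact ⟨by linarith, by linarith, by linarith⟩

theorem near_step {d : ℕ} {CV CE : ℝ} (hCV : 0 < CV) (hCE : 0 < CE) {S : EState d}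
    {o : EditOp d} (hS : S.WF) (ho : EditOp.legal S o) {i j : ℕ} (he : (i, j) ∈ S.edges) :
    Near CV CE (EditOp.cost CV CE S o) S (EditOp.apply S o) i j := by
  have hc := cost_nonneg hCV hCE S o
  cases o with
  | delVert k => exact near_of_eq hc rfl rfl
  | delEdge k l => exact near_of_eq hc rfl rfl
  | insEdge k l => exact near_of_eq hc rfl rfl
  | insVert k p =>
    have h1 : i ≠ k := fun h => ho (h ▸ (hS _ he).1)
    have h2 : j ≠ k := fun h => ho (h ▸ (hS _ he).2)
    exact near_of_eq hc (by simp [EditOp.apply, h1]) (by simp [EditOp.apply, h2])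
  | moveVert k p =>
    have hle := Finset.single_le_sum (f := fun e : ℕ × ℕ =>
        CE * |dist (Function.update S.pos k p e.1) (Function.update S.pos k p e.2)
                - dist (S.pos e.1) (S.pos e.2)|) (fun e _ => by positivity) he
    have h0 : 0 ≤ CV * dist (S.pos k) p := by positivity
    have hv : ∀ m, CV * dist (S.pos m) (Function.update S.pos k p m) ≤ CV * dist (S.pos k) p := by
      intro m
      by_cases h : m = k
      · subst h; simp
      · simpa [h] using h0
    have hn : 0 ≤ CE * |dist (Function.update S.pos k p i) (Function.update S.pos k p j)
                - dist (S.pos i) (S.pos j)| := by positivity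
    simp only [Near, EditOp.cost, EditOp.apply]
    simp only at hle
    refine ⟨?_, ?_, ?_⟩
    · rw [abs_sub_comm]; linarith
    · linarith [hv i]
    · linarith [hv j]

theorem step_fwd {d : ℕ} {CV CE : ℝ} {S : EState d}
    {o : EditOp d} {i j : ℕ} (he : (i, j) ∈ S.edges) :
    CE * dist (S.pos i) (S.pos j) ≤ EditOp.cost CV CE S o ∨
      (i, j) ∈ (EditOp.apply S o).edges := by
  cases o with
  | delEdge k l =>
    by_cases h : (i, j) = (k, l)
    · left
      obtain ⟨rfl, rfl⟩ := Prod.mk.inj h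
      exact le_rfl
    · right
      simp only [EditOp.apply]
      exact Finset.mem_erase.2 ⟨h, he⟩
  | insEdge k l => exact Or.inr (Finset.mem_insert_of_mem he)
  | delVert k => exact Or.inr he
  | insVert k p => exact Or.inr he
  | moveVert k p => exact Or.inr he

theorem step_bwd {d : ℕ} {CV CE : ℝ} {S : EState d}
    {o : EditOp d} {i j : ℕ} (he : (i, j) ∈ (EditOp.apply S o).edges) :
    CE * dist ((EditOp.apply S o).pos i) ((EditOp.apply S o).pos j) ≤ EditOp.cost CV CE S o ∨
      (i, j) ∈ S.edges := by
  cases o with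
  | delEdge k l => exact Or.inr (Finset.mem_of_mem_erase he)
  | insEdge k l =>
    rcases Finset.mem_insert.1 he with h | h
    · left
      obtain ⟨rfl, rfl⟩ := Prod.mk.inj h
      exact le_rfl
    · exact Or.inr h
  | delVert k => exact Or.inr he
  | insVert k p => exact Or.inr he
  | moveVert k p => exact Or.inr he

theorem path_fwd {d : ℕ} {CV CE : ℝ} (hCV : 0 < CV) (hCE : 0 < CE) (P : List (EditOp d)) :
    ∀ (S : EState d), S.WF → legalPath S P → 0 ≤ pathCost CV CE S P ∧
      ∀ i j, (i, j) ∈ S.edges →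
      CE * dist (S.pos i) (S.pos j) ≤ pathCost CV CE S P ∨
      ((i, j) ∈ (applyPath S P).edges ∧
        Near CV CE (pathCost CV CE S P) S (applyPath S P) i j) := by
  induction P with
  | nil =>
    intro S _ _
    exact ⟨le_rfl, fun i j he => Or.inr ⟨he, near_of_eq le_rfl rfl rfl⟩⟩
  | cons o P ih =>
    intro S hS hl
    obtain ⟨h0, ih⟩ := ih _ (WF_apply hS hl.1) hl.2
    have hc := cost_nonneg hCV hCE S o
    refine ⟨add_nonneg hc h0, fun i j he => ?_⟩
    have hn := near_step hCV hCE hS hl.1 he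
    simp only [pathCost]
    rcases step_fwd (CV := CV) (CE := CE) (o := o) he with h | h
    · left; linarith
    · rcases ih i j h with h' | ⟨h', hn'⟩
      · left
        have := mul_le_mul_of_nonneg_left (le_abs_self (dist (S.pos i) (S.pos j) -
          dist ((EditOp.apply S o).pos i) ((EditOp.apply S o).pos j))) hCE.le
        have := hn.1
        linarith
      · exact Or.inr ⟨h', near_trans hCV hCE hn hn'⟩

theorem path_bwd {d : ℕ} {CV CE : ℝ} (hCV : 0 < CV) (hCE : 0 < CE) (P : List (EditOp d)) :
    ∀ (S : EState d), S.WF → legalPath S P →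
      ∀ i j, (i, j) ∈ (applyPath S P).edges →
      CE * dist ((applyPath S P).pos i) ((applyPath S P).pos j) ≤ pathCost CV CE S P ∨
      ((i, j) ∈ S.edges ∧
        Near CV CE (pathCost CV CE S P) S (applyPath S P) i j) := by
  induction P with
  | nil =>
    intro S _ _ i j he
    exact Or.inr ⟨he, near_of_eq le_rfl rfl rfl⟩
  | cons o P ih =>
    intro S hS hl i j he
    have ih := ih _ (WF_apply hS hl.1) hl.2 i j he
    have hc := cost_nonneg hCV hCE S o
    change CE * dist ((applyPath (EditOp.apply S o) P).pos i)
      ((applyPath (EditOp.apply S o) P).pos j) ≤ _ ∨ (_ ∧ Near CV CE _ S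
        (applyPath (EditOp.apply S o) P) i j)
    simp only [pathCost]
    rcases ih with h | ⟨h, hn'⟩
    · left; linarith
    · rcases step_bwd (CV := CV) (CE := CE) (o := o) h with h' | h'
      · left
        have := mul_le_mul_of_nonneg_left (neg_le_abs (dist ((EditOp.apply S o).pos i)
          ((EditOp.apply S o).pos j) - dist ((applyPath (EditOp.apply S o) P).pos i)
          ((applyPath (EditOp.apply S o) P).pos j))) hCE.le
        have := hn'.1
        linarith
      · exact Or.inr ⟨h', near_trans hCV hCE (near_step hCV hCE hS hl.1 h') hn'⟩

/-- `T` is obtained from `S` by some legal edit path. -/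
def Reach {d : ℕ} (S T : EState d) : Prop := ∃ P, legalPath S P ∧ applyPath S P = T

theorem Reach.rfl' {d : ℕ} (S : EState d) : Reach S S := ⟨[], trivial, rfl⟩

theorem Reach.step {d : ℕ} {S T : EState d} (o : EditOp d) (ho : EditOp.legal S o)
    (h : Reach (EditOp.apply S o) T) : Reach S T := by
  obtain ⟨P, h1, h2⟩ := h
  exact ⟨o :: P, ⟨ho, h1⟩, h2⟩

theorem legalPath_append {d : ℕ} (P Q : List (EditOp d)) : ∀ S : EState d, legalPath S P →
    legalPath (applyPath S P) Q → legalPath S (P ++ Q) := by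
  induction P with
  | nil => intro S _ h; exact h
  | cons o P ih => intro S h h'; exact ⟨h.1, ih _ h.2 h'⟩

theorem Reach.trans' {d : ℕ} {S T U : EState d} (h : Reach S T) (h' : Reach T U) :
    Reach S U := by
  obtain ⟨P, h1, rfl⟩ := h
  obtain ⟨Q, h2, rfl⟩ := h'
  exact ⟨P ++ Q, legalPath_append P Q S h1 h2, by simp [applyPath, List.foldl_append]⟩

theorem reach_delEdges {d : ℕ} (V : Finset ℕ) (pos : ℕ → Pt d) (E : Finset (ℕ × ℕ)) :
    Reach ⟨V, pos, E⟩ ⟨V, pos, ∅⟩ := by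
  induction E using Finset.induction_on with
  | empty => exact Reach.rfl' _
  | insert e E he ih =>
    refine Reach.step (.delEdge e.1 e.2) (Finset.mem_insert_self _ _) ?_
    simpa [EditOp.apply, he] using ih

theorem reach_insEdges {d : ℕ} (V : Finset ℕ) (pos : ℕ → Pt d) (E : Finset (ℕ × ℕ))
    (hE : ∀ e ∈ E, e.1 ∈ V ∧ e.2 ∈ V) :
    Reach ⟨V, pos, ∅⟩ ⟨V, pos, E⟩ := by
  induction E using Finset.induction_on with
  | empty => exact Reach.rfl' _
  | insert e E he ih =>
    refine Reach.trans' (ih fun f hf => hE f (Finset.mem_insert_of_mem hf)) ?_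
    have := hE e (Finset.mem_insert_self _ _)
    exact Reach.step (.insEdge e.1 e.2) ⟨this.1, this.2, he⟩ (Reach.rfl' _)

theorem reach_delVerts {d : ℕ} (V : Finset ℕ) (pos : ℕ → Pt d) :
    Reach ⟨V, pos, ∅⟩ ⟨∅, pos, ∅⟩ := by
  induction V using Finset.induction_on with
  | empty => exact Reach.rfl' _
  | insert e E he ih =>
    refine Reach.step (.delVert e) ⟨Finset.mem_insert_self _ _, by simp⟩ ?_
    simpa [EditOp.apply, he] using ih

theorem reach_insVerts {d : ℕ} (V : Finset ℕ) (pos : ℕ → Pt d) :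
    Reach ⟨∅, pos, ∅⟩ ⟨V, pos, ∅⟩ := by
  induction V using Finset.induction_on with
  | empty => exact Reach.rfl' _
  | insert e E he ih =>
    refine Reach.trans' ih (Reach.step (.insVert e (pos e)) he ?_)
    simpa [EditOp.apply] using Reach.rfl' _

theorem represents_image {d : ℕ} (lab : Pt d → ℕ) (pos : ℕ → Pt d) (G : GeoGraph d)
    (h : ∀ u ∈ G.verts, pos (lab u) = u) :
    EState.Represents ⟨G.verts.image lab, pos, G.edges.image fun e => (lab e.1, lab e.2)⟩
      G.toEGraph := by
  refine ⟨?_, ?_, ?_, ?_⟩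
  · intro a ha b hb hab
    simp only [Finset.coe_image, Set.mem_image, Finset.mem_coe] at ha hb
    obtain ⟨u, hu, rfl⟩ := ha
    obtain ⟨v, hv, rfl⟩ := hb
    simp only [h u hu, h v hv] at hab
    rw [hab]
  · ext u
    simp only [Finset.mem_image, exists_exists_and_eq_and]
    constructor
    · rintro ⟨a, ha, rfl⟩; rwa [h a ha]
    · intro hu; exact ⟨u, hu, h u hu⟩
  · intro e he
    obtain ⟨f, hf, rfl⟩ := Finset.mem_image.1 he
    exact ⟨Finset.mem_image_of_mem _ (G.edge_fst_mem f hf),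
      Finset.mem_image_of_mem _ (G.edge_snd_mem f hf)⟩
  · have key : ∀ f ∈ G.edges, (pos (lab f.1), pos (lab f.2)) = f := fun f hf => by
      rw [h _ (G.edge_fst_mem f hf), h _ (G.edge_snd_mem f hf)]
    ext e
    simp only [Finset.mem_image, exists_exists_and_eq_and]
    constructor
    · rintro ⟨a, ha, rfl⟩; rwa [key a ha]
    · intro he; exact ⟨e, he, key e he⟩

theorem exists_editPath {d : ℕ} (G H : GeoGraph d) :
    ∃ (S : EState d) (P : List (EditOp d)), IsEditPathFrom G.toEGraph H.toEGraph S P := by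
  obtain ⟨lab, hlab⟩ := Set.countable_iff_exists_injOn.1
    (G.verts ∪ H.verts).finite_toSet.countable
  let pos : ℕ → Pt d := Function.invFunOn lab ↑(G.verts ∪ H.verts)
  have hp : ∀ u ∈ G.verts ∪ H.verts, pos (lab u) = u := fun u hu =>
    hlab.leftInvOn_invFunOn hu
  have hG := represents_image lab pos G fun u hu => hp u (Finset.mem_union_left _ hu)
  have hH := represents_image lab pos H fun u hu => hp u (Finset.mem_union_right _ hu)
  obtain ⟨P, h1, h2⟩ := (((reach_delEdges (G.verts.image lab) pos
    (G.edges.image fun e => (lab e.1, lab e.2))).trans' (reach_delVerts _ _)).trans'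
    (reach_insVerts (H.verts.image lab) pos)).trans'
    (reach_insEdges _ _ (H.edges.image fun e => (lab e.1, lab e.2)) hH.2.2.1)
  exact ⟨_, P, hG, h1, h2 ▸ hH⟩

theorem exists_small (T : Finset ℝ) : ∃ ε > 0, ∀ t ∈ T, 0 < t → ε ≤ t := by
  induction T using Finset.induction_on with
  | empty => exact ⟨1, one_pos, by simp⟩
  | insert a T _ ih =>
    obtain ⟨ε, h0, h⟩ := ih
    by_cases ha : 0 < a
    · refine ⟨min a ε, lt_min ha h0, fun t ht h' => ?_⟩
      rcases Finset.mem_insert.1 ht with rfl | ht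
      · exact min_le_left _ _
      · exact (min_le_right _ _).trans (h t ht h')
    · refine ⟨ε, h0, fun t ht h' => ?_⟩
      rcases Finset.mem_insert.1 ht with rfl | ht
      · exact absurd h' ha
      · exact h t ht h'

theorem verts_sub {d : ℕ} {G H : GeoGraph d} (hG : NoIsolated G.toEGraph)
    (h : G.edges = H.edges) : G.verts ⊆ H.verts := by
  intro u hu
  obtain ⟨e, he, h1 | h1⟩ := hG u hu
  · exact h1 ▸ H.edge_fst_mem e (h ▸ he)
  · exact h1 ▸ H.edge_snd_mem e (h ▸ he)

/-- If `G` and `H` are geometric graphs without isolated vertices and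
`GED(G,H) = 0`, then `G = H`, i.e. `V^G = V^H` and `E^G = E^H`. -/
theorem ged_eq_zero_implies_eq {d : ℕ} (CV CE : ℝ) (hCV : 0 < CV) (hCE : 0 < CE)
    (G H : GeoGraph d) (hG : NoIsolated G.toEGraph) (hH : NoIsolated H.toEGraph)
    (h : GED CV CE G H = 0) :
    G.verts = H.verts ∧ G.edges = H.edges := by
  suffices hE : G.edges = H.edges from
    ⟨Finset.Subset.antisymm (verts_sub hG hE) (verts_sub hH hE.symm), hE⟩
  set W := G.verts ∪ H.verts with hW
  obtain ⟨ε, hε, hsmall⟩ := exists_small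
    (((W ×ˢ W).image fun e => CE * dist e.1 e.2) ∪ ((W ×ˢ W).image fun e => CV * dist e.1 e.2))
  have hsE : ∀ u ∈ W, ∀ v ∈ W, u ≠ v → ε ≤ CE * dist u v := fun u hu v hv huv =>
    hsmall _ (Finset.mem_union_left _ (Finset.mem_image.2
      ⟨(u, v), Finset.mem_product.2 ⟨hu, hv⟩, rfl⟩)) (mul_pos hCE (dist_pos.2 huv))
  have hsV : ∀ u ∈ W, ∀ v ∈ W, CV * dist u v < ε → u = v := fun u hu v hv hlt => by
    by_contra huv
    exact absurd (hsmall _ (Finset.mem_union_right _ (Finset.mem_image.2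
      ⟨(u, v), Finset.mem_product.2 ⟨hu, hv⟩, rfl⟩)) (mul_pos hCV (dist_pos.2 huv))) hlt.not_ge
  obtain ⟨S₀, P₀, h₀⟩ := exists_editPath G H
  obtain ⟨c, ⟨S, P, ⟨hSG, hl, hTH⟩, rfl⟩, hlt⟩ := Real.lt_sInf_add_pos
    (s := {c : ℝ | ∃ (S : EState d) (P : List (EditOp d)),
    IsEditPathFrom G.toEGraph H.toEGraph S P ∧ pathCost CV CE S P = c}) ⟨_, S₀, P₀, h₀, rfl⟩ hε
  change _ < GED CV CE G H + ε at hlt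
  rw [h, zero_add] at hlt
  have hWF : S.WF := hSG.2.2.1
  have hGW : ∀ u ∈ G.verts, u ∈ W := fun u hu => Finset.mem_union_left _ hu
  have hHW : ∀ u ∈ H.verts, u ∈ W := fun u hu => Finset.mem_union_right _ hu
  have hGE : ∀ i j, (i, j) ∈ S.edges → (S.pos i, S.pos j) ∈ G.edges := fun i j hij => by
    rw [← hSG.2.2.2]; exact Finset.mem_image.2 ⟨(i, j), hij, rfl⟩
  have hHE : ∀ i j, (i, j) ∈ (applyPath S P).edges →
      ((applyPath S P).pos i, (applyPath S P).pos j) ∈ H.edges := fun i j hij => by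
    rw [← hTH.2.2.2]; exact Finset.mem_image.2 ⟨(i, j), hij, rfl⟩
  have hnear : ∀ i j, (i, j) ∈ S.edges → (i, j) ∈ (applyPath S P).edges →
      Near CV CE (pathCost CV CE S P) S (applyPath S P) i j →
      S.pos i = (applyPath S P).pos i ∧ S.pos j = (applyPath S P).pos j := by
    intro i j h1 h2 hn
    have a := hGE i j h1
    have b := hHE i j h2
    exact ⟨hsV _ (hGW _ (G.edge_fst_mem _ a)) _ (hHW _ (H.edge_fst_mem _ b))
        (hn.2.1.trans_lt hlt),
      hsV _ (hGW _ (G.edge_snd_mem _ a)) _ (hHW _ (H.edge_snd_mem _ b))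
        (hn.2.2.trans_lt hlt)⟩
  apply Finset.Subset.antisymm
  · intro e he
    have he' := he
    rw [← hSG.2.2.2] at he'
    obtain ⟨⟨i, j⟩, hij, rfl⟩ := Finset.mem_image.1 he'
    rcases (path_fwd hCV hCE P S hWF hl).2 i j hij with h1 | ⟨h1, hn⟩
    · have := hsE _ (hGW _ (G.edge_fst_mem _ he)) _ (hGW _ (G.edge_snd_mem _ he))
        (G.edge_ne _ he)
      simp only at this
      linarith
    · obtain ⟨a, b⟩ := hnear i j hij h1 hn
      simp only [a, b]
      exact hHE i j h1
  · intro e he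
    have he' := he
    rw [← hTH.2.2.2] at he'
    obtain ⟨⟨i, j⟩, hij, rfl⟩ := Finset.mem_image.1 he'
    rcases path_bwd hCV hCE P S hWF hl i j hij with h1 | ⟨h1, hn⟩
    · have := hsE _ (hHW _ (H.edge_fst_mem _ he)) _ (hHW _ (H.edge_snd_mem _ he))
        (H.edge_ne _ he)
      simp only at this
      linarith
    · obtain ⟨a, b⟩ := hnear i j h1 hij hn
      simp only [← a, ← b]
      exact hGE i j h1
end
end

section
/- The geometric edit distance GED defines a metric on the space of geometric graphs of ℝ^d without isolated vertices: it is non-negative, GED(G,H)=0 if and only if G=H, it is symmetric, and it satisfies the triangle inequality. -/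
open scoped Classical
noncomputable section

namespace GEDProof

variable {d : ℕ}

/-- Edges of a state join existing vertices. -/
def WF (S : EState d) : Prop := ∀ i j, (i, j) ∈ S.edges → i ∈ S.verts ∧ j ∈ S.verts

/-- Two states agree up to relabelling and up to positions of unused labels. -/
def Iso (σ : Equiv.Perm ℕ) (S T : EState d) : Prop :=
  (∀ i, i ∈ S.verts ↔ σ i ∈ T.verts) ∧
  (∀ i j, (i, j) ∈ S.edges ↔ (σ i, σ j) ∈ T.edges) ∧
  ∀ i ∈ S.verts, T.pos (σ i) = S.pos i

theorem Iso.symm {σ : Equiv.Perm ℕ} {S T : EState d} (h : Iso σ S T) : Iso σ⁻¹ T S := by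
  obtain ⟨h1, h2, h3⟩ := h
  refine ⟨fun i => ?_, fun i j => ?_, fun i hi => ?_⟩
  · simp [h1]
  · simp [h2]
  · rw [← h3 _ (by simpa [h1] using hi)]; simp

theorem Iso.trans {σ τ : Equiv.Perm ℕ} {S T U : EState d} (h : Iso σ S T) (k : Iso τ T U) :
    Iso (τ * σ) S U := by
  obtain ⟨h1, h2, h3⟩ := h
  obtain ⟨k1, k2, k3⟩ := k
  refine ⟨fun i => ?_, fun i j => ?_, fun i hi => ?_⟩
  · simp [h1, k1]
  · simp [h2, k2]
  · simp [k3 _ ((h1 i).1 hi), h3 i hi]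

theorem Iso.refl (S : EState d) : Iso 1 S S := by
  simp [Iso]

theorem Iso.wf {σ : Equiv.Perm ℕ} {S T : EState d} (h : Iso σ S T) (hS : WF S) : WF T := by
  intro i j hij
  have h' := h.symm
  have := hS _ _ ((h'.2.1 i j).1 hij)
  exact ⟨(h'.1 i).2 this.1, (h'.1 j).2 this.2⟩

theorem wf_apply {S : EState d} (hS : WF S) {o : EditOp d} (ho : EditOp.legal S o) :
    WF (EditOp.apply S o) := by
  intro a b hab
  cases o with
  | delVert i =>
    simp only [EditOp.apply, EditOp.legal, Finset.mem_erase] at *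
    have := hS a b hab
    have h2 := ho.2 (a, b) hab
    exact ⟨⟨h2.1, this.1⟩, ⟨h2.2, this.2⟩⟩
  | insVert i p =>
    simp only [EditOp.apply, Finset.mem_insert] at *
    have := hS a b hab
    exact ⟨Or.inr this.1, Or.inr this.2⟩
  | delEdge i j =>
    simp only [EditOp.apply, Finset.mem_erase] at *
    exact hS a b hab.2
  | insEdge i j =>
    simp only [EditOp.apply, EditOp.legal, Finset.mem_insert, Prod.mk.injEq] at *
    rcases hab with ⟨rfl, rfl⟩ | hab
    · exact ⟨ho.1, ho.2.1⟩
    · exact hS a b hab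
  | moveVert i p =>
    simp only [EditOp.apply] at *
    exact hS a b hab

/-- Relabelling of an operation. -/
def relabel (σ : Equiv.Perm ℕ) : EditOp d → EditOp d
  | .delVert i => .delVert (σ i)
  | .insVert i p => .insVert (σ i) p
  | .delEdge i j => .delEdge (σ i) (σ j)
  | .insEdge i j => .insEdge (σ i) (σ j)
  | .moveVert i p => .moveVert (σ i) p

theorem sim_step (CV CE : ℝ) {σ : Equiv.Perm ℕ} {S T : EState d} (hS : WF S) (h : Iso σ S T)
    {o : EditOp d} (ho : EditOp.legal S o) :
    EditOp.legal T (relabel σ o) ∧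
    EditOp.cost CV CE T (relabel σ o) = EditOp.cost CV CE S o ∧
    Iso σ (EditOp.apply S o) (EditOp.apply T (relabel σ o)) := by
  have h' := h.symm
  obtain ⟨h1, h2, h3⟩ := h
  cases o with
  | delVert i =>
    refine ⟨⟨(h1 i).1 ho.1, fun e he => ?_⟩, rfl, ?_, h2, ?_⟩
    · have := ho.2 _ ((h'.2.1 e.1 e.2).1 he)
      constructor
      · rintro h; apply this.1; simp [h]
      · rintro h; apply this.2; simp [h]
    · intro k; simp [EditOp.apply, relabel, h1]
    · intro k hk
      simp only [EditOp.apply, Finset.mem_erase, relabel] at *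
      exact h3 k hk.2
  | insVert i p =>
    refine ⟨fun hi => ho ((h1 i).2 hi), rfl, ?_, h2, ?_⟩
    · intro k; simp [EditOp.apply, relabel, h1]
    · intro k hk
      simp only [EditOp.apply, Finset.mem_insert, relabel] at *
      by_cases hki : k = i
      · subst hki; simp
      · rw [Function.update_of_ne (by simpa using hki), Function.update_of_ne hki]
        exact h3 k (hk.resolve_left hki)
  | delEdge i j =>
    have hv := hS i j ho
    refine ⟨(h2 i j).1 ho, ?_, h1, ?_, h3⟩
    · simp [EditOp.cost, relabel, h3 i hv.1, h3 j hv.2]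
    · intro a b; simp [EditOp.apply, relabel, h2]
  | insEdge i j =>
    refine ⟨⟨(h1 i).1 ho.1, (h1 j).1 ho.2.1, fun hh => ho.2.2 ((h2 i j).2 hh)⟩, ?_, h1, ?_, h3⟩
    · simp [EditOp.cost, relabel, h3 i ho.1, h3 j ho.2.1]
    · intro a b; simp [EditOp.apply, relabel, h2]
  | moveVert i p =>
    have hup : ∀ k ∈ S.verts, Function.update T.pos (σ i) p (σ k) = Function.update S.pos i p k := by
      intro k hk
      by_cases hki : k = i
      · subst hki; simp
      · rw [Function.update_of_ne (by simpa using hki), Function.update_of_ne hki]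
        exact h3 k hk
    refine ⟨(h1 i).1 ho, ?_, h1, h2, hup⟩
    simp only [EditOp.cost, relabel, h3 i ho]
    congr 1
    symm
    refine Finset.sum_equiv (σ.prodCongr σ) ?_ ?_
    · rintro ⟨a, b⟩; exact h2 a b
    · rintro ⟨a, b⟩ hab
      have hv := hS a b hab
      simp [hup a hv.1, hup b hv.2, h3 a hv.1, h3 b hv.2]

theorem sim_path (CV CE : ℝ) {σ : Equiv.Perm ℕ} (P : List (EditOp d)) : ∀ {S T : EState d},
    WF S → Iso σ S T → legalPath S P →
    ∃ Q, legalPath T Q ∧ pathCost CV CE T Q = pathCost CV CE S P ∧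
      Iso σ (applyPath S P) (applyPath T Q) := by
  induction P with
  | nil => intro S T _ h _; exact ⟨[], trivial, rfl, h⟩
  | cons o P ih =>
    intro S T hS h hP
    obtain ⟨a, b, c⟩ := sim_step CV CE hS h hP.1
    obtain ⟨Q, q1, q2, q3⟩ := ih (wf_apply hS hP.1) c hP.2
    exact ⟨relabel σ o :: Q, ⟨a, q1⟩, by simp [pathCost, b, q2], q3⟩

theorem legalPath_append (P : List (EditOp d)) : ∀ {S : EState d} {Q : List (EditOp d)},
    legalPath S P → legalPath (applyPath S P) Q → legalPath S (P ++ Q) := by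
  induction P with
  | nil => intro S Q _ h; exact h
  | cons o P ih => intro S Q h k; exact ⟨h.1, ih h.2 k⟩

theorem applyPath_append (P Q : List (EditOp d)) (S : EState d) :
    applyPath S (P ++ Q) = applyPath (applyPath S P) Q := by
  simp [applyPath]

theorem pathCost_append (CV CE : ℝ) (P Q : List (EditOp d)) : ∀ (S : EState d),
    pathCost CV CE S (P ++ Q) = pathCost CV CE S P + pathCost CV CE (applyPath S P) Q := by
  induction P with
  | nil => intro S; simp [pathCost, applyPath]
  | cons o P ih =>
    intro S
    simp only [List.cons_append, pathCost, ih, applyPath, List.foldl_cons, add_assoc]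

theorem wf_path (P : List (EditOp d)) : ∀ {S : EState d}, WF S → legalPath S P →
    WF (applyPath S P) := by
  induction P with
  | nil => intro S h _; exact h
  | cons o P ih => intro S h k; exact ih (wf_apply h k.1) k.2

theorem inv_step (CV CE : ℝ) {S : EState d} (hS : WF S) {o : EditOp d} (ho : EditOp.legal S o) :
    EditOp.legal (EditOp.apply S o) (EditOp.inv S o) ∧
    EditOp.cost CV CE (EditOp.apply S o) (EditOp.inv S o) = EditOp.cost CV CE S o ∧
    Iso 1 (EditOp.apply (EditOp.apply S o) (EditOp.inv S o)) S := by
  cases o with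
  | delVert i =>
    refine ⟨by simp [EditOp.legal, EditOp.apply, EditOp.inv], rfl, ?_, ?_, ?_⟩
    · intro k; simp [EditOp.apply, EditOp.inv, Finset.insert_erase ho.1]
    · intro a b; simp [EditOp.apply, EditOp.inv]
    · intro k _; simp [EditOp.apply, EditOp.inv]
  | insVert i p =>
    refine ⟨⟨by simp [EditOp.apply], ?_⟩, rfl, ?_, ?_, ?_⟩
    · rintro ⟨a, b⟩ he
      have := hS a b he
      refine ⟨?_, ?_⟩
      · rintro rfl; exact ho this.1
      · rintro rfl; exact ho this.2
    · intro k; simp [EditOp.apply, EditOp.inv, Finset.erase_insert ho]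
    · intro a b; simp [EditOp.apply, EditOp.inv]
    · intro k hk
      have : k ≠ i := by
        simp only [EditOp.apply, EditOp.inv, Finset.mem_erase] at hk
        exact hk.1
      simp [EditOp.apply, EditOp.inv, this]
  | delEdge i j =>
    have hv := hS i j ho
    refine ⟨⟨hv.1, hv.2, by simp [EditOp.apply]⟩, rfl, ?_, ?_, ?_⟩
    · intro k; simp [EditOp.apply, EditOp.inv]
    · intro a b
      have : insert (i, j) (S.edges.erase (i, j)) = S.edges := Finset.insert_erase ho
      simp only [EditOp.apply, EditOp.inv, Equiv.Perm.one_apply]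
      rw [this]
    · intro k _; simp [EditOp.apply, EditOp.inv]
  | insEdge i j =>
    refine ⟨by simp [EditOp.legal, EditOp.apply, EditOp.inv], rfl, ?_, ?_, ?_⟩
    · intro k; simp [EditOp.apply, EditOp.inv]
    · intro a b
      have : (insert (i, j) S.edges).erase (i, j) = S.edges := Finset.erase_insert ho.2.2
      simp only [EditOp.apply, EditOp.inv, Equiv.Perm.one_apply]
      rw [this]
    · intro k _; simp [EditOp.apply, EditOp.inv]
  | moveVert i p =>
    refine ⟨ho, ?_, ?_, ?_, ?_⟩
    · simp only [EditOp.cost, EditOp.apply, EditOp.inv, Function.update_idem,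
        Function.update_eq_self, Function.update_self]
      rw [dist_comm]
      congr 1
      refine Finset.sum_congr rfl fun e _ => ?_
      rw [abs_sub_comm]
    · intro k; simp [EditOp.apply, EditOp.inv]
    · intro a b; simp [EditOp.apply, EditOp.inv]
    · intro k _; simp [EditOp.apply, EditOp.inv]

theorem inv_path (CV CE : ℝ) (P : List (EditOp d)) : ∀ {S : EState d}, WF S → legalPath S P →
    ∃ Q σ, legalPath (applyPath S P) Q ∧
      pathCost CV CE (applyPath S P) Q = pathCost CV CE S P ∧
      Iso σ S (applyPath (applyPath S P) Q) := by
  induction P with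
  | nil => intro S h _; exact ⟨[], 1, trivial, rfl, Iso.refl S⟩
  | cons o P ih =>
    intro S hS hP
    have hS1 := wf_apply hS hP.1
    obtain ⟨Q, σ, q1, q2, q3⟩ := ih hS1 hP.2
    obtain ⟨a, b, c⟩ := inv_step CV CE hS hP.1
    obtain ⟨R, r1, r2, r3⟩ := sim_path CV CE [EditOp.inv S o] hS1 q3 ⟨a, trivial⟩
    refine ⟨Q ++ R, σ * 1⁻¹, legalPath_append Q q1 r1, ?_, ?_⟩
    · rw [pathCost_append]
      change pathCost CV CE (applyPath (EditOp.apply S o) P) Q +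
        pathCost CV CE (applyPath (applyPath (EditOp.apply S o) P) Q) R = _
      rw [q2, r2]
      simp only [pathCost, b]
      ring
    · rw [applyPath_append]
      exact c.symm.trans r3

theorem rep_wf {S : EState d} {G : EGraph d} (h : S.Represents G) : WF S :=
  fun i j hij => h.2.2.1 (i, j) hij

theorem Iso.rep {σ : Equiv.Perm ℕ} {S T : EState d} {G : EGraph d} (h : Iso σ S T)
    (hS : S.Represents G) : T.Represents G := by
  have hwT := h.wf (rep_wf hS)
  have hw := rep_wf hS
  have h' := h.symm
  obtain ⟨r1, r2, r3, r4⟩ := hS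
  refine ⟨?_, ?_, fun e he => hwT e.1 e.2 he, ?_⟩
  · intro i hi j hj hij
    have := r1 ((h'.1 i).1 hi) ((h'.1 j).1 hj) (by rw [h'.2.2 i hi, h'.2.2 j hj, hij])
    exact σ⁻¹.injective this
  · rw [← r2]
    ext x
    simp only [Finset.mem_image]
    constructor
    · rintro ⟨i, hi, rfl⟩; exact ⟨σ⁻¹ i, (h'.1 i).1 hi, h'.2.2 i hi⟩
    · rintro ⟨i, hi, rfl⟩; exact ⟨σ i, (h.1 i).1 hi, h.2.2 i hi⟩
  · rw [← r4]
    ext x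
    simp only [Finset.mem_image]
    constructor
    · rintro ⟨⟨i, j⟩, hi, rfl⟩
      have := hwT i j hi
      exact ⟨(σ⁻¹ i, σ⁻¹ j), (h'.2.1 i j).1 hi, by simp only [h'.2.2 i this.1, h'.2.2 j this.2]⟩
    · rintro ⟨⟨i, j⟩, hi, rfl⟩
      have := hw i j hi
      exact ⟨(σ i, σ j), (h.2.1 i j).1 hi, by simp only [h.2.2 i this.1, h.2.2 j this.2]⟩

theorem rep_edge {S : EState d} {G : EGraph d} (h : S.Represents G) {i j : ℕ}
    (hi : i ∈ S.verts) (hj : j ∈ S.verts) :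
    (i, j) ∈ S.edges ↔ (S.pos i, S.pos j) ∈ G.edges := by
  have hw := rep_wf h
  obtain ⟨r1, r2, r3, r4⟩ := h
  rw [← r4, Finset.mem_image]
  constructor
  · intro h; exact ⟨(i, j), h, rfl⟩
  · rintro ⟨⟨a, b⟩, hab, he⟩
    have hv := hw a b hab
    simp only [Prod.mk.injEq] at he
    have e1 := r1 hv.1 hi he.1
    have e2 := r1 hv.2 hj he.2
    rwa [← e1, ← e2]

theorem rep_iso {S T : EState d} {G : EGraph d} (hS : S.Represents G) (hT : T.Represents G) :
    ∃ σ, Iso σ S T := by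
  have key : ∀ i : S.verts, ∃ j : T.verts, T.pos j = S.pos i := by
    intro i
    have : S.pos i ∈ T.verts.image T.pos := by
      rw [hT.2.1, ← hS.2.1]; exact Finset.mem_image_of_mem _ i.2
    obtain ⟨j, hj, e⟩ := Finset.mem_image.1 this
    exact ⟨⟨j, hj⟩, e⟩
  choose f hf using key
  obtain ⟨σ, hσ⟩ := Equiv.Perm.exists_extending_pair (fun i : S.verts => (i : ℕ))
    (fun i => (f i : ℕ)) Subtype.val_injective (by
      intro i j hij
      have : S.pos i = S.pos j := by
        rw [← hf i, ← hf j]; exact congrArg T.pos hij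
      exact Subtype.ext (hS.1 i.2 j.2 this))
  have h1 : ∀ i, i ∈ S.verts → σ i ∈ T.verts ∧ T.pos (σ i) = S.pos i := by
    intro i hi
    have := hσ ⟨i, hi⟩
    simp only at this
    rw [this]
    exact ⟨(f ⟨i, hi⟩).2, hf _⟩
  have h2 : ∀ i, σ i ∈ T.verts → i ∈ S.verts := by
    intro i hi
    have : T.pos (σ i) ∈ S.verts.image S.pos := by
      rw [hS.2.1, ← hT.2.1]; exact Finset.mem_image_of_mem _ hi
    obtain ⟨j, hj, e⟩ := Finset.mem_image.1 this
    have hh := h1 j hj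
    have : σ j = σ i := hT.1 hh.1 hi (by rw [hh.2, e])
    rwa [← σ.injective this]
  refine ⟨σ, fun i => ⟨fun hi => (h1 i hi).1, h2 i⟩, fun i j => ?_, fun i hi => (h1 i hi).2⟩
  constructor
  · intro hij
    have hv := rep_wf hS i j hij
    rw [rep_edge hT (h1 i hv.1).1 (h1 j hv.2).1, (h1 i hv.1).2, (h1 j hv.2).2]
    exact (rep_edge hS hv.1 hv.2).1 hij
  · intro hij
    have hv := rep_wf hT _ _ hij
    have a := h2 i hv.1
    have b := h2 j hv.2
    rw [rep_edge hS a b, ← (h1 i a).2, ← (h1 j b).2]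
    exact (rep_edge hT hv.1 hv.2).1 hij

theorem exists_rep (G : GeoGraph d) : ∃ S : EState d, S.Represents G.toEGraph := by
  obtain ⟨f, hf⟩ := Set.countable_iff_exists_injOn.1 (G.verts.finite_toSet.countable)
  have hinv : ∀ x ∈ G.verts, Function.invFunOn f (G.verts : Set (Pt d)) (f x) = x :=
    fun x hx => hf.leftInvOn_invFunOn hx
  refine ⟨⟨G.verts.image f, Function.invFunOn f G.verts,
    G.edges.image fun e => (f e.1, f e.2)⟩, ?_, ?_, ?_, ?_⟩
  · intro i hi j hj hij
    simp only [Finset.coe_image, Set.mem_image, Finset.mem_coe] at hi hj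
    obtain ⟨x, hx, rfl⟩ := hi
    obtain ⟨y, hy, rfl⟩ := hj
    simp only [hinv x hx, hinv y hy] at hij
    rw [hij]
  · ext x
    simp only [Finset.mem_image, exists_exists_and_eq_and]
    constructor
    · rintro ⟨a, ha, rfl⟩; rwa [hinv a ha]
    · intro hx; exact ⟨x, hx, hinv x hx⟩
  · intro e he
    simp only [Finset.mem_image] at he
    obtain ⟨e', he', rfl⟩ := he
    exact ⟨Finset.mem_image_of_mem _ (G.edge_fst_mem e' he'),
      Finset.mem_image_of_mem _ (G.edge_snd_mem e' he')⟩
  · ext x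
    simp only [Finset.mem_image, exists_exists_and_eq_and]
    constructor
    · rintro ⟨a, ha, rfl⟩
      rwa [hinv _ (G.edge_fst_mem a ha), hinv _ (G.edge_snd_mem a ha)]
    · intro hx
      exact ⟨x, hx, by rw [hinv _ (G.edge_fst_mem x hx), hinv _ (G.edge_snd_mem x hx)]⟩

theorem clear_edges : ∀ (n : ℕ) (S : EState d), S.edges.card = n →
    ∃ P, legalPath S P ∧ (applyPath S P).edges = ∅ := by
  intro n
  induction n with
  | zero => intro S h; exact ⟨[], trivial, Finset.card_eq_zero.1 h⟩
  | succ n ih =>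
    intro S h
    obtain ⟨⟨i, j⟩, he⟩ := Finset.card_pos.1 (by omega : 0 < S.edges.card)
    obtain ⟨P, p1, p2⟩ := ih (EditOp.apply S (.delEdge i j)) (by
      have : (S.edges.erase (i, j)).card = n := by rw [Finset.card_erase_of_mem he, h]; rfl
      exact this)
    exact ⟨.delEdge i j :: P, ⟨he, p1⟩, p2⟩

theorem clear_verts : ∀ (n : ℕ) (S : EState d), S.edges = ∅ → S.verts.card = n →
    ∃ P, legalPath S P ∧ (applyPath S P).edges = ∅ ∧ (applyPath S P).verts = ∅ := by
  intro n
  induction n with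
  | zero => intro S h0 h; exact ⟨[], trivial, h0, Finset.card_eq_zero.1 h⟩
  | succ n ih =>
    intro S h0 h
    obtain ⟨i, he⟩ := Finset.card_pos.1 (by omega : 0 < S.verts.card)
    obtain ⟨P, p1, p2⟩ := ih (EditOp.apply S (.delVert i)) h0 (by
      have : (S.verts.erase i).card = n := by rw [Finset.card_erase_of_mem he, h]; rfl
      exact this)
    exact ⟨.delVert i :: P, ⟨⟨he, by simp [h0]⟩, p1⟩, p2⟩

theorem clear_all (S : EState d) :
    ∃ P, legalPath S P ∧ (applyPath S P).edges = ∅ ∧ (applyPath S P).verts = ∅ := by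
  obtain ⟨P, p1, p2⟩ := clear_edges _ S rfl
  obtain ⟨Q, q1, q2⟩ := clear_verts _ _ p2 rfl
  exact ⟨P ++ Q, legalPath_append P p1 q1, by rwa [applyPath_append]⟩

/-- The set of costs of edit paths. -/
def costs (CV CE : ℝ) (G H : GeoGraph d) : Set ℝ :=
  {c : ℝ | ∃ (S : EState d) (P : List (EditOp d)),
    IsEditPathFrom G.toEGraph H.toEGraph S P ∧ pathCost CV CE S P = c}

theorem costs_nonempty (CV CE : ℝ) (G H : GeoGraph d) : (costs CV CE G H).Nonempty := by
  obtain ⟨S, hS⟩ := exists_rep G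
  obtain ⟨T, hT⟩ := exists_rep H
  obtain ⟨P, p1, p2, p3⟩ := clear_all S
  obtain ⟨Q, q1, q2, q3⟩ := clear_all T
  obtain ⟨R, σ, r1, -, r3⟩ := inv_path CV CE Q (rep_wf hT) q1
  have hiso : Iso 1 (applyPath T Q) (applyPath S P) := by simp [Iso, p2, p3, q2, q3]
  obtain ⟨R', s1, -, s3⟩ := sim_path CV CE R (wf_path Q (rep_wf hT) q1) hiso r1
  refine ⟨_, S, P ++ R', ⟨hS, legalPath_append P p1 s1, ?_⟩, rfl⟩
  rw [applyPath_append]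
  exact s3.rep (r3.rep hT)

theorem cost_nonneg {CV CE : ℝ} (hCV : 0 < CV) (hCE : 0 < CE) (S : EState d) (o : EditOp d) :
    0 ≤ EditOp.cost CV CE S o := by
  cases o <;> simp only [EditOp.cost] <;> positivity

theorem pathCost_nonneg {CV CE : ℝ} (hCV : 0 < CV) (hCE : 0 < CE) (P : List (EditOp d)) :
    ∀ S : EState d, 0 ≤ pathCost CV CE S P := by
  induction P with
  | nil => intro S; exact le_rfl
  | cons o P ih => intro S; exact add_nonneg (cost_nonneg hCV hCE S o) (ih _)

theorem costs_nonneg {CV CE : ℝ} (hCV : 0 < CV) (hCE : 0 < CE) (G H : GeoGraph d) :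
    ∀ c ∈ costs CV CE G H, 0 ≤ c := by
  rintro c ⟨S, P, -, rfl⟩
  exact pathCost_nonneg hCV hCE P S

theorem costs_bdd {CV CE : ℝ} (hCV : 0 < CV) (hCE : 0 < CE) (G H : GeoGraph d) :
    BddBelow (costs CV CE G H) := ⟨0, costs_nonneg hCV hCE G H⟩

theorem costs_symm (CV CE : ℝ) (G H : GeoGraph d) : costs CV CE G H ⊆ costs CV CE H G := by
  rintro c ⟨S, P, ⟨h1, h2, h3⟩, rfl⟩
  obtain ⟨Q, σ, q1, q2, q3⟩ := inv_path CV CE P (rep_wf h1) h2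
  exact ⟨_, Q, ⟨h3, q1, q3.rep h1⟩, q2⟩

theorem costs_add {CV CE : ℝ} {G H I : GeoGraph d} {a b : ℝ} (ha : a ∈ costs CV CE G H)
    (hb : b ∈ costs CV CE H I) : a + b ∈ costs CV CE G I := by
  obtain ⟨S, P, ⟨h1, h2, h3⟩, rfl⟩ := ha
  obtain ⟨T, Q, ⟨k1, k2, k3⟩, rfl⟩ := hb
  obtain ⟨σ, hσ⟩ := rep_iso k1 h3
  obtain ⟨R, r1, r2, r3⟩ := sim_path CV CE Q (rep_wf k1) hσ k2
  refine ⟨S, P ++ R, ⟨h1, legalPath_append P h2 r1, ?_⟩, ?_⟩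
  · rw [applyPath_append]; exact r3.rep k3
  · rw [pathCost_append, r2]

theorem step_track {CV CE : ℝ} (hCV : 0 < CV) (hCE : 0 < CE) {S : EState d} (hS : WF S)
    {o : EditOp d} (ho : EditOp.legal S o) {i j : ℕ} (hij : (i, j) ∈ S.edges)
    (hc : EditOp.cost CV CE S o < CE * dist (S.pos i) (S.pos j)) :
    (i, j) ∈ (EditOp.apply S o).edges ∧
    CE * dist (S.pos i) (S.pos j) - EditOp.cost CV CE S o ≤
      CE * dist ((EditOp.apply S o).pos i) ((EditOp.apply S o).pos j) ∧
    CV * dist (S.pos i) ((EditOp.apply S o).pos i) ≤ EditOp.cost CV CE S o ∧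
    CV * dist (S.pos j) ((EditOp.apply S o).pos j) ≤ EditOp.cost CV CE S o := by
  have hv := hS i j hij
  have hnn := cost_nonneg hCV hCE S o
  cases o with
  | delVert k => exact ⟨hij, by simp [EditOp.apply, EditOp.cost]⟩
  | insVert k p =>
    have h1 : i ≠ k := by rintro rfl; exact ho hv.1
    have h2 : j ≠ k := by rintro rfl; exact ho hv.2
    exact ⟨hij, by simp [EditOp.apply, EditOp.cost, h1, h2]⟩
  | delEdge a b =>
    have hne : (i, j) ≠ (a, b) := by
      rintro h
      simp only [Prod.mk.injEq] at h
      obtain ⟨rfl, rfl⟩ := h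
      exact lt_irrefl _ hc
    refine ⟨Finset.mem_erase.2 ⟨hne, hij⟩, ?_, ?_, ?_⟩
    · simp only [EditOp.apply]; linarith
    · simpa [EditOp.apply] using hnn
    · simpa [EditOp.apply] using hnn
  | insEdge a b =>
    refine ⟨Finset.mem_insert_of_mem hij, ?_, ?_, ?_⟩
    · simp only [EditOp.apply]; linarith
    · simpa [EditOp.apply] using hnn
    · simpa [EditOp.apply] using hnn
  | moveVert k p =>
    have hsum := Finset.single_le_sum (s := S.edges)
      (f := fun e => CE * |dist (Function.update S.pos k p e.1) (Function.update S.pos k p e.2)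
                - dist (S.pos e.1) (S.pos e.2)|) (fun e _ => by positivity) hij
    have hmv : ∀ l, CV * dist (S.pos l) (Function.update S.pos k p l) ≤ CV * dist (S.pos k) p := by
      intro l
      by_cases h : l = k
      · subst h; simp
      · rw [Function.update_of_ne h]; simp; positivity
    have h0 : 0 ≤ CV * dist (S.pos k) p := by positivity
    have h1 : 0 ≤ CE * |dist (Function.update S.pos k p i) (Function.update S.pos k p j)
                - dist (S.pos i) (S.pos j)| := by positivity
    have habs := mul_le_mul_of_nonneg_left (neg_le_abs (dist (Function.update S.pos k p i)
      (Function.update S.pos k p j) - dist (S.pos i) (S.pos j))) hCE.le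
    simp only at hsum
    have m1 := hmv i
    have m2 := hmv j
    refine ⟨hij, ?_, ?_, ?_⟩ <;> simp only [EditOp.apply, EditOp.cost] <;> linarith

theorem path_track {CV CE : ℝ} (hCV : 0 < CV) (hCE : 0 < CE) (P : List (EditOp d)) :
    ∀ {S : EState d}, WF S → legalPath S P → ∀ {i j : ℕ}, (i, j) ∈ S.edges →
    pathCost CV CE S P < CE * dist (S.pos i) (S.pos j) →
    (i, j) ∈ (applyPath S P).edges ∧
    CV * dist (S.pos i) ((applyPath S P).pos i) ≤ pathCost CV CE S P ∧
    CV * dist (S.pos j) ((applyPath S P).pos j) ≤ pathCost CV CE S P := by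
  induction P with
  | nil => intro S _ _ i j hij _; exact ⟨hij, by simp [applyPath, pathCost]⟩
  | cons o P ih =>
    intro S hS hP i j hij hc
    simp only [pathCost] at hc ⊢
    have hnn := pathCost_nonneg hCV hCE P (EditOp.apply S o)
    obtain ⟨a, b, c, e⟩ := step_track hCV hCE hS hP.1 hij (by linarith)
    obtain ⟨a', c', e'⟩ := ih (wf_apply hS hP.1) hP.2 a (by linarith)
    refine ⟨a', ?_, ?_⟩
    · have := mul_le_mul_of_nonneg_left (dist_triangle (S.pos i) ((EditOp.apply S o).pos i)
        ((applyPath (EditOp.apply S o) P).pos i)) hCV.le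
      change CV * dist (S.pos i) ((applyPath (EditOp.apply S o) P).pos i) ≤ _
      linarith
    · have := mul_le_mul_of_nonneg_left (dist_triangle (S.pos j) ((EditOp.apply S o).pos j)
        ((applyPath (EditOp.apply S o) P).pos j)) hCV.le
      change CV * dist (S.pos j) ((applyPath (EditOp.apply S o) P).pos j) ≤ _
      linarith

theorem edges_subset {CV CE : ℝ} (hCV : 0 < CV) (hCE : 0 < CE) {G H : GeoGraph d}
    (h : GED CV CE G H = 0) : G.edges ⊆ H.edges := by
  intro e he
  have hcl : e ∈ closure (H.edges : Set (Pt d × Pt d)) := by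
    rw [Metric.mem_closure_iff]
    intro ε hε
    have hlen : 0 < CE * dist e.1 e.2 := mul_pos hCE (dist_pos.2 (G.edge_ne e he))
    obtain ⟨c, ⟨S, P, ⟨h1, h2, h3⟩, rfl⟩, hlt⟩ := exists_lt_of_csInf_lt
      (costs_nonempty CV CE G H) (b := min (CE * dist e.1 e.2) (CV * ε))
      (by
        change GED CV CE G H < _
        rw [h]
        exact lt_min hlen (by positivity))
    have he' := he
    rw [← h1.2.2.2, Finset.mem_image] at he'
    obtain ⟨⟨i, j⟩, hij, rfl⟩ := he'
    obtain ⟨a, b, c⟩ := path_track hCV hCE P (rep_wf h1) h2 hij (hlt.trans_le (min_le_left _ _))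
    have hlt2 := hlt.trans_le (min_le_right _ _)
    refine ⟨((applyPath S P).pos i, (applyPath S P).pos j), ?_, ?_⟩
    · rw [← h3.2.2.2]
      exact Finset.mem_coe.2 (Finset.mem_image.2 ⟨(i, j), a, rfl⟩)
    · rw [Prod.dist_eq]
      refine max_lt ?_ ?_
      · exact lt_of_mul_lt_mul_left (b.trans_lt hlt2) hCV.le
      · exact lt_of_mul_lt_mul_left (c.trans_lt hlt2) hCV.le
  rw [H.edges.finite_toSet.isClosed.closure_eq] at hcl
  exact Finset.mem_coe.1 hcl

theorem verts_subset {G H : GeoGraph d} (hG : NoIsolated G.toEGraph) (h : G.edges ⊆ H.edges) :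
    G.verts ⊆ H.verts := by
  intro u hu
  obtain ⟨e, he, h1 | h1⟩ := hG u hu
  · rw [← h1]; exact H.edge_fst_mem e (h he)
  · rw [← h1]; exact H.edge_snd_mem e (h he)

theorem geo_ext {G H : GeoGraph d} (h1 : G.verts = H.verts) (h2 : G.edges = H.edges) : G = H := by
  obtain ⟨⟨v, e⟩, _, _, _, _⟩ := G
  obtain ⟨⟨v', e'⟩, _, _, _, _⟩ := H
  simp only at h1 h2
  subst h1 h2
  rfl

theorem ged_symm (CV CE : ℝ) (G H : GeoGraph d) : GED CV CE G H = GED CV CE H G :=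
  congrArg sInf (Set.Subset.antisymm (costs_symm CV CE G H) (costs_symm CV CE H G))

theorem ged_nonneg {CV CE : ℝ} (hCV : 0 < CV) (hCE : 0 < CE) (G H : GeoGraph d) :
    0 ≤ GED CV CE G H := Real.sInf_nonneg (costs_nonneg hCV hCE G H)

end GEDProof

/-- `GED` is a metric on the space of geometric graphs of `ℝ^d` without isolated
vertices: it is non-negative, zero exactly on equal graphs, symmetric, and satisfies the
triangle inequality. -/
theorem ged_is_metric {d : ℕ} (CV CE : ℝ) (hCV : 0 < CV) (hCE : 0 < CE) :
    (∀ G H : GeoGraph d, NoIsolated G.toEGraph → NoIsolated H.toEGraph →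
      0 ≤ GED CV CE G H) ∧
    (∀ G H : GeoGraph d, NoIsolated G.toEGraph → NoIsolated H.toEGraph →
      (GED CV CE G H = 0 ↔ G = H)) ∧
    (∀ G H : GeoGraph d, NoIsolated G.toEGraph → NoIsolated H.toEGraph →
      GED CV CE G H = GED CV CE H G) ∧
    (∀ G H I : GeoGraph d, NoIsolated G.toEGraph → NoIsolated H.toEGraph →
      NoIsolated I.toEGraph → GED CV CE G I ≤ GED CV CE G H + GED CV CE H I) := by
  open GEDProof in
  refine ⟨fun G H _ _ => ged_nonneg hCV hCE G H, fun G H hG hH => ⟨fun h => ?_, ?_⟩,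
    fun G H _ _ => ged_symm CV CE G H, fun G H I _ _ _ => ?_⟩
  · have h1 := GEDProof.edges_subset hCV hCE h
    have h2 := GEDProof.edges_subset hCV hCE ((GEDProof.ged_symm CV CE H G).trans h)
    exact GEDProof.geo_ext
      ((GEDProof.verts_subset hG h1).antisymm (GEDProof.verts_subset hH h2)) (h1.antisymm h2)
  · rintro rfl
    refine le_antisymm ?_ (GEDProof.ged_nonneg hCV hCE G G)
    obtain ⟨S, hS⟩ := GEDProof.exists_rep G
    exact csInf_le (GEDProof.costs_bdd hCV hCE G G) ⟨S, [], ⟨hS, trivial, hS⟩, rfl⟩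
  · refine le_of_forall_pos_le_add fun ε hε => ?_
    obtain ⟨a, ha, ha'⟩ := exists_lt_of_csInf_lt (GEDProof.costs_nonempty CV CE G H)
      (b := GED CV CE G H + ε / 2) (lt_add_of_pos_right (GED CV CE G H) (by positivity))
    obtain ⟨b, hb, hb'⟩ := exists_lt_of_csInf_lt (GEDProof.costs_nonempty CV CE H I)
      (b := GED CV CE H I + ε / 2) (lt_add_of_pos_right (GED CV CE H I) (by positivity))
    have : GED CV CE G I ≤ a + b :=
      csInf_le (GEDProof.costs_bdd hCV hCE G I) (GEDProof.costs_add ha hb)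
    linarith
end
end

section
/- Let G and H be geometric graphs in ℝ^d. For any inexact matching π between G and H, Cost(π) ≥ Σ_{u∈V^G, π(u)≠ε_V} C_V·|u−π(u)| + C_E·|Vol(G)−Vol(H)| + 2·min{ Σ_{e∈E^G, π(e)=ε_E} C_E·|e| , Σ_{f∈E^H, π^{-1}(f)=ε_E} C_E·|f| }. -/
open scoped Classical
noncomputable section

theorem mEdge_eq_some {d : ℕ} (T : EGraph d) (φ : Pt d → Option (Pt d)) (e p : Pt d × Pt d) :
    mEdge T φ e = some p ↔ φ e.1 = some p.1 ∧ φ e.2 = some p.2 ∧ p ∈ T.edges := by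
  obtain ⟨a, b⟩ := p
  unfold mEdge
  cases h1 : φ e.1 with
  | none => simp
  | some x =>
    cases h2 : φ e.2 with
    | none => simp
    | some y =>
      simp only [Option.ite_none_right_eq_some, Option.some.injEq, Prod.mk.injEq]
      constructor
      · rintro ⟨h, rfl, rfl⟩
        exact ⟨rfl, rfl, h⟩
      · rintro ⟨rfl, rfl, h⟩
        exact ⟨h, rfl, rfl⟩

/-- Matched edges correspond to each other in both directions. -/
theorem mEdge_swap {d : ℕ} {G H : GeoGraph d} (m : Matching d G.toEGraph H.toEGraph)
    {e p : Pt d × Pt d} (he : e ∈ G.edges) (hp : p ∈ H.edges) :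
    mEdge H.toEGraph m.f e = some p ↔ mEdge G.toEGraph m.g p = some e := by
  rw [mEdge_eq_some, mEdge_eq_some,
    m.consistent _ (G.edge_fst_mem e he) _ (H.edge_fst_mem p hp),
    m.consistent _ (G.edge_snd_mem e he) _ (H.edge_snd_mem p hp)]
  tauto

/-- The matched edges of both graphs have the same total length via the matching. -/
theorem matched_sum {d : ℕ} {G H : GeoGraph d} (m : Matching d G.toEGraph H.toEGraph) :
    ∑ e ∈ G.edges.filter (fun e => mEdge H.toEGraph m.f e ≠ none),
      elen (mEdge H.toEGraph m.f e) =
    ∑ p ∈ H.edges.filter (fun p => ¬ mEdge G.toEGraph m.g p = none), dist p.1 p.2 := by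
  refine Finset.sum_bij (fun e _ => (mEdge H.toEGraph m.f e).getD e) ?_ ?_ ?_ ?_
  · intro e he
    obtain ⟨he, hn⟩ := Finset.mem_filter.1 he
    obtain ⟨p, hp⟩ := Option.ne_none_iff_exists'.1 hn
    have hpH : p ∈ H.edges := ((mEdge_eq_some _ _ _ _).1 hp).2.2
    simp [hp, hpH, (mEdge_swap m he hpH).1 hp]
  · intro e he e' he' heq
    obtain ⟨he, hn⟩ := Finset.mem_filter.1 he
    obtain ⟨he', hn'⟩ := Finset.mem_filter.1 he'
    obtain ⟨p, hp⟩ := Option.ne_none_iff_exists'.1 hn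
    obtain ⟨p', hp'⟩ := Option.ne_none_iff_exists'.1 hn'
    have hpH : p ∈ H.edges := ((mEdge_eq_some _ _ _ _).1 hp).2.2
    simp only [hp, hp', Option.getD_some] at heq
    subst heq
    have h1 := (mEdge_swap m he hpH).1 hp
    have h2 := (mEdge_swap m he' hpH).1 hp'
    rw [h1] at h2
    exact Option.some.inj h2
  · intro p hp
    obtain ⟨hp, hn⟩ := Finset.mem_filter.1 hp
    obtain ⟨e, he⟩ := Option.ne_none_iff_exists'.1 hn
    have heG : e ∈ G.edges := ((mEdge_eq_some _ _ _ _).1 he).2.2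
    have h := (mEdge_swap m heG hp).2 he
    exact ⟨e, Finset.mem_filter.2 ⟨heG, by simp [h]⟩, by simp [h]⟩
  · intro e he
    obtain ⟨he, hn⟩ := Finset.mem_filter.1 he
    obtain ⟨p, hp⟩ := Option.ne_none_iff_exists'.1 hn
    simp [hp, elen]

/-- For any inexact matching `π` between geometric graphs `G`, `H` of `ℝ^d`,
`Cost(π) ≥ Σ_{u ∈ V^G, π(u) ≠ ε_V} C_V·|u − π(u)| + C_E·|Vol(G) − Vol(H)|
  + 2·min{Σ_{e ∈ E^G, π(e) = ε_E} C_E·|e|, Σ_{f ∈ E^H, π⁻¹(f) = ε_E} C_E·|f|}`. -/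
theorem matchCost_lower_bound {d : ℕ} (CV CE : ℝ) (hCV : 0 < CV) (hCE : 0 < CE)
    (G H : GeoGraph d) (m : Matching d G.toEGraph H.toEGraph) :
    matchCost CV CE m ≥
      (∑ u ∈ G.verts.filter (fun u => m.f u ≠ none), CV * odist (some u) (m.f u)) +
      CE * |G.toEGraph.vol - H.toEGraph.vol| +
      2 * min (∑ e ∈ G.edges.filter (fun e => mEdge H.toEGraph m.f e = none),
                CE * dist e.1 e.2)
              (∑ f ∈ H.edges.filter (fun f => mEdge G.toEGraph m.g f = none),
                CE * dist f.1 f.2) := by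
  unfold matchCost
  have hG : G.toEGraph.vol = _ := (Finset.sum_filter_add_sum_filter_not G.edges
    (fun e => mEdge H.toEGraph m.f e = none) (fun e => dist e.1 e.2)).symm
  have hH : H.toEGraph.vol = _ := (Finset.sum_filter_add_sum_filter_not H.edges
    (fun e => mEdge G.toEGraph m.g e = none) (fun e => dist e.1 e.2)).symm
  have hM := matched_sum m
  have hA := Finset.abs_sum_le_sum_abs
    (fun e : Pt d × Pt d => dist e.1 e.2 - elen (mEdge H.toEGraph m.f e))
    (G.edges.filter (fun e => mEdge H.toEGraph m.f e ≠ none))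
  rw [Finset.sum_sub_distrib, hM] at hA
  simp only [← Finset.mul_sum]
  rw [hG, hH, ← mul_min_of_nonneg _ _ hCE.le]
  simp only [ne_eq] at hA ⊢
  set a := ∑ e ∈ G.edges with mEdge H.toEGraph m.f e = none, dist e.1 e.2
  set b := ∑ e ∈ H.edges with mEdge G.toEGraph m.g e = none, dist e.1 e.2
  set x := ∑ e ∈ G.edges with ¬ mEdge H.toEGraph m.f e = none, dist e.1 e.2
  set y := ∑ e ∈ H.edges with ¬ mEdge G.toEGraph m.g e = none, dist e.1 e.2
  set s := ∑ e ∈ G.edges with ¬ mEdge H.toEGraph m.f e = none,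
    |dist e.1 e.2 - elen (mEdge H.toEGraph m.f e)|
  have key : |a + x - (b + y)| + 2 * min a b ≤ s + a + b := by
    have h1 := (abs_le.1 hA)
    rcases min_cases a b with h | h <;>
      rcases abs_cases (a + x - (b + y)) with h' | h' <;> linarith [h1.1, h1.2]
  have := mul_le_mul_of_nonneg_left key hCE.le
  linarith
end
end

section
/- Let G and H be geometric graphs in ℝ^d without isolated vertices. If GGD(G,H) = 0 then G = H, i.e. V^G = V^H and E^G = E^H. -/
open scoped Classical
noncomputable section

theorem matchCost_congr_aux {d : ℕ} (CV CE : ℝ) (G H : GeoGraph d)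
    (m m' : Matching d G.toEGraph H.toEGraph)
    (hf : ∀ u ∈ G.verts, m.f u = m'.f u) (hg : ∀ v ∈ H.verts, m.g v = m'.g v) :
    matchCost CV CE m = matchCost CV CE m' := by
  have h1 : ∀ e ∈ G.edges, mEdge H.toEGraph m.f e = mEdge H.toEGraph m'.f e := by
    intro e he
    unfold mEdge
    rw [hf _ (G.edge_fst_mem e he), hf _ (G.edge_snd_mem e he)]
  have h2 : ∀ e ∈ H.edges, mEdge G.toEGraph m.g e = mEdge G.toEGraph m'.g e := by
    intro e he
    unfold mEdge
    rw [hg _ (H.edge_fst_mem e he), hg _ (H.edge_snd_mem e he)]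
  unfold matchCost
  simp only [Finset.sum_filter]
  congr 1
  · congr 1
    · congr 1
      · exact Finset.sum_congr rfl fun u hu => by rw [hf u hu]
      · exact Finset.sum_congr rfl fun u hu => by rw [h1 u hu]
    · exact Finset.sum_congr rfl fun u hu => by rw [h1 u hu]
  · exact Finset.sum_congr rfl fun u hu => by rw [h2 u hu]

theorem costs_finite_aux {d : ℕ} (CV CE : ℝ) (G H : GeoGraph d) :
    {c : ℝ | ∃ m : Matching d G.toEGraph H.toEGraph, matchCost CV CE m = c}.Finite := by
  let F : Matching d G.toEGraph H.toEGraph →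
      (G.verts → Option (Pt d)) × (H.verts → Option (Pt d)) :=
    fun m => (fun u => m.f u, fun v => m.g v)
  have hfac : Function.FactorsThrough (fun m => matchCost CV CE m) F := by
    intro m m' hmm
    have a := congrArg Prod.fst hmm
    have b := congrArg Prod.snd hmm
    exact matchCost_congr_aux CV CE G H m m' (fun u hu => congrFun a ⟨u, hu⟩)
      (fun v hv => congrFun b ⟨v, hv⟩)
  have hfin : (Set.range F).Finite := by
    have hA : (Set.pi Set.univ (fun _ : G.verts =>
        ((Finset.insertNone H.verts : Finset (Option (Pt d))) : Set (Option (Pt d))))).Finite :=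
      Set.Finite.pi fun _ => Finset.finite_toSet _
    have hB : (Set.pi Set.univ (fun _ : H.verts =>
        ((Finset.insertNone G.verts : Finset (Option (Pt d))) : Set (Option (Pt d))))).Finite :=
      Set.Finite.pi fun _ => Finset.finite_toSet _
    refine (hA.prod hB).subset ?_
    rintro _ ⟨m, rfl⟩
    refine ⟨fun u _ => ?_, fun v _ => ?_⟩
    · exact Finset.mem_coe.2 (Finset.mem_insertNone.2 fun a ha => m.f_mem u u.2 a ha)
    · exact Finset.mem_coe.2 (Finset.mem_insertNone.2 fun a ha => m.g_mem v v.2 a ha)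
  refine (hfin.image (Function.extend F (fun m => matchCost CV CE m) 0)).subset ?_
  rintro c ⟨m, rfl⟩
  exact ⟨F m, ⟨m, rfl⟩, hfac.extend_apply 0 m⟩

theorem mEdge_ne_none_aux {d : ℕ} (T : EGraph d) (φ : Pt d → Option (Pt d)) (e : Pt d × Pt d)
    (h : mEdge T φ e ≠ none) :
    ∃ a b, φ e.1 = some a ∧ φ e.2 = some b ∧ (a, b) ∈ T.edges := by
  unfold mEdge at h
  split at h
  · rename_i a b ha hb
    refine ⟨a, b, ha, hb, ?_⟩
    by_contra hn
    simp [hn] at h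
  · exact absurd rfl h

/-- If `G` and `H` are geometric graphs without isolated vertices and
`GGD(G,H) = 0`, then `G = H`, i.e. `V^G = V^H` and `E^G = E^H`. -/
theorem ggd_eq_zero_implies_eq {d : ℕ} (CV CE : ℝ) (hCV : 0 < CV) (hCE : 0 < CE)
    (G H : GeoGraph d) (hG : NoIsolated G.toEGraph) (hH : NoIsolated H.toEGraph)
    (h : GGD CV CE G H = 0) :
    G.verts = H.verts ∧ G.edges = H.edges := by
  have hne : {c : ℝ | ∃ m : Matching d G.toEGraph H.toEGraph, matchCost CV CE m = c}.Nonempty :=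
    ⟨_, ⟨fun _ => none, fun _ => none, by simp, by simp, by simp⟩, rfl⟩
  have hmem := hne.csInf_mem (costs_finite_aux CV CE G H)
  change GGD CV CE G H ∈ _ at hmem
  rw [h] at hmem
  obtain ⟨m, hm⟩ := hmem
  unfold matchCost at hm
  have p1 : ∀ u ∈ G.verts.filter (fun u => m.f u ≠ none), 0 ≤ CV * odist (some u) (m.f u) := by
    intro u _
    refine mul_nonneg hCV.le ?_
    cases m.f u with
    | none => exact le_rfl
    | some a => exact dist_nonneg
  have p2 : ∀ e ∈ G.edges.filter (fun e => mEdge H.toEGraph m.f e ≠ none),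
      0 ≤ CE * |dist e.1 e.2 - elen (mEdge H.toEGraph m.f e)| :=
    fun _ _ => mul_nonneg hCE.le (abs_nonneg _)
  have p3 : ∀ e ∈ G.edges.filter (fun e => mEdge H.toEGraph m.f e = none),
      0 ≤ CE * dist e.1 e.2 := fun _ _ => mul_nonneg hCE.le dist_nonneg
  have p4 : ∀ e ∈ H.edges.filter (fun e => mEdge G.toEGraph m.g e = none),
      0 ≤ CE * dist e.1 e.2 := fun _ _ => mul_nonneg hCE.le dist_nonneg
  have s1 := Finset.sum_nonneg p1
  have s2 := Finset.sum_nonneg p2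
  have s3 := Finset.sum_nonneg p3
  have s4 := Finset.sum_nonneg p4
  have z1 := (Finset.sum_eq_zero_iff_of_nonneg p1).1 (by linarith)
  have z3 := (Finset.sum_eq_zero_iff_of_nonneg p3).1 (by linarith)
  have z4 := (Finset.sum_eq_zero_iff_of_nonneg p4).1 (by linarith)
  have hf : ∀ u ∈ G.verts, ∀ v, m.f u = some v → u = v := by
    intro u hu v huv
    have := z1 u (Finset.mem_filter.2 ⟨hu, by simp [huv]⟩)
    rw [huv] at this
    exact dist_eq_zero.1 ((mul_eq_zero.1 this).resolve_left hCV.ne')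
  have hg : ∀ v ∈ H.verts, ∀ u, m.g v = some u → u = v := by
    intro v hv u hvu
    have hu := m.g_mem v hv u hvu
    exact hf u hu v ((m.consistent u hu v hv).2 hvu)
  have hGH : ∀ e ∈ G.edges, e ∈ H.edges := by
    intro e he
    have hn : mEdge H.toEGraph m.f e ≠ none := by
      intro hn
      have := z3 e (Finset.mem_filter.2 ⟨he, hn⟩)
      exact G.edge_ne e he (dist_eq_zero.1 ((mul_eq_zero.1 this).resolve_left hCE.ne'))
    obtain ⟨a, b, ha, hb, hab⟩ := mEdge_ne_none_aux _ _ _ hn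
    rw [← hf _ (G.edge_fst_mem e he) a ha, ← hf _ (G.edge_snd_mem e he) b hb] at hab
    exact hab
  have hHG : ∀ e ∈ H.edges, e ∈ G.edges := by
    intro e he
    have hn : mEdge G.toEGraph m.g e ≠ none := by
      intro hn
      have := z4 e (Finset.mem_filter.2 ⟨he, hn⟩)
      exact H.edge_ne e he (dist_eq_zero.1 ((mul_eq_zero.1 this).resolve_left hCE.ne'))
    obtain ⟨a, b, ha, hb, hab⟩ := mEdge_ne_none_aux _ _ _ hn
    rw [hg _ (H.edge_fst_mem e he) a ha, hg _ (H.edge_snd_mem e he) b hb] at hab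
    exact hab
  refine ⟨?_, Finset.ext fun e => ⟨hGH e, hHG e⟩⟩
  ext u
  constructor
  · intro hu
    obtain ⟨e, he, rfl | rfl⟩ := hG u hu
    · exact H.edge_fst_mem e (hGH e he)
    · exact H.edge_snd_mem e (hGH e he)
  · intro hu
    obtain ⟨e, he, rfl | rfl⟩ := hH u hu
    · exact G.edge_fst_mem e (hHG e he)
    · exact G.edge_snd_mem e (hHG e he)
end
end

section
/- For all geometric graphs G, H, and I in ℝ^d, GGD(G,I) ≤ GGD(G,H) + GGD(H,I). -/
open scoped Classical
noncomputable section

theorem ggdaux_reidx {α β : Type*} (s : Finset α) (t : Finset β) (i : α → Option β) (F : β → ℝ)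
    (hF : ∀ b ∈ t, 0 ≤ F b) (hmem : ∀ a ∈ s, ∀ b, i a = some b → b ∈ t)
    (hinj : ∀ a ∈ s, ∀ a' ∈ s, ∀ b, i a = some b → i a' = some b → a = a') :
    ∑ a ∈ s, (i a).elim 0 F ≤ ∑ b ∈ t, F b := by
  have h1 : ∀ a ∈ s, (i a).elim 0 F = ∑ b ∈ t, if i a = some b then F b else 0 := by
    intro a ha
    rcases hia : i a with _ | b
    · simp
    · have := hmem a ha b hia
      simp [this]
  rw [Finset.sum_congr rfl h1, Finset.sum_comm]
  refine Finset.sum_le_sum fun b hb => ?_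
  by_cases h : ∃ a ∈ s, i a = some b
  · obtain ⟨a, ha, hab⟩ := h
    rw [Finset.sum_eq_single_of_mem a ha]
    · simp [hab]
    · intro a' ha' hne
      rw [if_neg]
      intro h'
      exact hne (hinj a' ha' a ha b h' hab)
  · rw [Finset.sum_eq_zero]
    · exact hF b hb
    · intro a ha
      rw [if_neg]
      intro h'
      exact h ⟨a, ha, h'⟩

theorem ggdaux_edges {E : Type*} (L : E → ℝ) (hL : ∀ e, 0 ≤ L e) (A B C : Finset E)
    (p p' q q' r r' : E → Option E)
    (hp : ∀ a ∈ A, ∀ b, p a = some b → b ∈ B ∧ p' b = some a)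
    (hp' : ∀ b ∈ B, ∀ a, p' b = some a → a ∈ A ∧ p a = some b)
    (hq : ∀ a ∈ B, ∀ b, q a = some b → b ∈ C ∧ q' b = some a)
    (hq' : ∀ b ∈ C, ∀ a, q' b = some a → a ∈ B ∧ q a = some b)
    (hr : ∀ a ∈ A, ∀ b, r a = some b → b ∈ C ∧ r' b = some a)
    (hpq : ∀ a ∈ A, ∀ b, p a = some b → r a = q b)
    (hqp : ∀ c ∈ C, ∀ b, q' c = some b → r' c = p' b) :
    (∑ a ∈ A, |L a - (r a).elim 0 L|) + (∑ c ∈ C, if r' c = none then L c else 0) ≤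
    ((∑ a ∈ A, |L a - (p a).elim 0 L|) + (∑ c ∈ B, if p' c = none then L c else 0)) +
    ((∑ a ∈ B, |L a - (q a).elim 0 L|) + (∑ c ∈ C, if q' c = none then L c else 0)) := by
  have e1 : ∑ a ∈ A, |L a - (r a).elim 0 L| ≤ ∑ a ∈ A, |L a - (p a).elim 0 L| +
      ∑ a ∈ A, (p a).elim 0
        (fun b => if p' b = none then 0 else |L b - (q b).elim 0 L|) +
      ∑ a ∈ A, (r a).elim 0
        (fun c => if q' c = none ∧ r' c ≠ none then L c else 0) := by
    rw [← Finset.sum_add_distrib, ← Finset.sum_add_distrib]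
    refine Finset.sum_le_sum fun a ha => ?_
    rcases hpa : p a with _ | b
    · rcases hra : r a with _ | c
      · simp
      · obtain ⟨hc, hrc⟩ := hr a ha c hra
        have hqc : q' c = none := by
          rcases h : q' c with _ | b
          · rfl
          · have h1 := hqp c hc b h
            rw [hrc] at h1
            have h2 := hp' b (hq' c hc b h).1 a h1.symm
            rw [hpa] at h2
            simp at h2
        simp only [Option.elim_none, Option.elim_some, hqc, hrc]
        have := hL a
        have := hL c
        simp
        rw [abs_le, abs_of_nonneg (hL a)]
        constructor <;> linarith
    · obtain ⟨hb, hpb⟩ := hp a ha b hpa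
      rw [hpq a ha b hpa]
      have h3 : 0 ≤ (q b).elim 0 (fun c => if q' c = none ∧ r' c ≠ none then L c else 0) := by
        rcases q b with _ | c
        · simp
        · simp only [Option.elim_some]
          split_ifs
          · exact hL c
          · exact le_rfl
      simp only [Option.elim_some, hpb]
      have := abs_sub_le (L a) (L b) ((q b).elim 0 L)
      simp only [reduceCtorEq, if_false]
      linarith
  have e2 := ggdaux_reidx A B p
    (fun b => if p' b = none then 0 else |L b - (q b).elim 0 L|)
    (by intro b hb; split_ifs <;> positivity)
    (fun a ha b h => (hp a ha b h).1)
    (by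
      intro a ha a' ha' b h h'
      have h1 := (hp a ha b h).2
      rw [(hp a' ha' b h').2] at h1
      simpa using h1.symm)
  have e3 := ggdaux_reidx A C r
    (fun c => if q' c = none ∧ r' c ≠ none then L c else 0)
    (by intro b hb; split_ifs; exacts [hL b, le_rfl])
    (fun a ha b h => (hr a ha b h).1)
    (by
      intro a ha a' ha' b h h'
      have h1 := (hr a ha b h).2
      rw [(hr a' ha' b h').2] at h1
      simpa using h1.symm)
  have e4 : (∑ c ∈ C, if r' c = none then L c else 0) ≤
      (∑ c ∈ C, if q' c = none ∧ r' c = none then L c else 0) +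
      ∑ c ∈ C, (q' c).elim 0
        (fun b => if p' b = none then L b + |L b - (q b).elim 0 L| else 0) := by
    rw [← Finset.sum_add_distrib]
    refine Finset.sum_le_sum fun c hc => ?_
    rcases hqc : q' c with _ | b
    · simp
    · rw [hqp c hc b hqc]
      have := (hq' c hc b hqc).2
      simp only [this, Option.elim_some, reduceCtorEq, false_and, if_false]
      split_ifs
      · have := neg_abs_le (L b - L c)
        linarith
      · simp
  have e5 := ggdaux_reidx C B q'
    (fun b => if p' b = none then L b + |L b - (q b).elim 0 L| else 0)
    (by
      intro b hb; split_ifs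
      · have := hL b
        positivity
      · exact le_rfl)
    (fun a ha b h => (hq' a ha b h).1)
    (by
      intro a ha a' ha' b h h'
      have h1 := (hq' a ha b h).2
      rw [(hq' a' ha' b h').2] at h1
      simpa using h1.symm)
  have e6 : (∑ b ∈ B, if p' b = none then 0 else |L b - (q b).elim 0 L|) +
      (∑ b ∈ B, if p' b = none then L b + |L b - (q b).elim 0 L| else 0) =
      (∑ a ∈ B, |L a - (q a).elim 0 L|) + (∑ c ∈ B, if p' c = none then L c else 0) := by
    rw [← Finset.sum_add_distrib, ← Finset.sum_add_distrib]
    refine Finset.sum_congr rfl fun b hb => ?_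
    split_ifs <;> ring
  have e7 : (∑ c ∈ C, if q' c = none ∧ r' c ≠ none then L c else 0) +
      (∑ c ∈ C, if q' c = none ∧ r' c = none then L c else 0) =
      ∑ c ∈ C, if q' c = none then L c else 0 := by
    rw [← Finset.sum_add_distrib]
    refine Finset.sum_congr rfl fun b hb => ?_
    by_cases h1 : q' b = none <;> by_cases h2 : r' b = none <;> simp [h1, h2]
  linarith

theorem ggdaux_mEdge {d : ℕ} (T : EGraph d) (φ : Pt d → Option (Pt d)) (e f : Pt d × Pt d) :
    mEdge T φ e = some f ↔ φ e.1 = some f.1 ∧ φ e.2 = some f.2 ∧ f ∈ T.edges := by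
  obtain ⟨f1, f2⟩ := f
  unfold mEdge
  rcases φ e.1 with _ | a <;> rcases φ e.2 with _ | b <;> simp
  constructor
  · rintro ⟨h, rfl, rfl⟩
    exact ⟨rfl, rfl, h⟩
  · rintro ⟨rfl, rfl, h⟩
    exact ⟨h, rfl, rfl⟩

theorem ggdaux_cost {d : ℕ} (CV CE : ℝ) {G H : EGraph d} (m : Matching d G H) :
    matchCost CV CE m = CV * (∑ u ∈ G.verts, odist (some u) (m.f u)) +
      CE * ((∑ a ∈ G.edges, |dist a.1 a.2 - (mEdge H m.f a).elim 0 (fun e => dist e.1 e.2)|) +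
        (∑ c ∈ H.edges, if mEdge G m.g c = none then dist c.1 c.2 else 0)) := by
  unfold matchCost
  rw [mul_add, Finset.mul_sum, Finset.mul_sum, Finset.mul_sum]
  simp only [Finset.sum_filter]
  rw [← add_assoc]
  congr 1
  · rw [add_assoc, ← Finset.sum_add_distrib]
    congr 1
    · refine Finset.sum_congr rfl fun u _ => ?_
      rcases m.f u with _ | v <;> simp [odist]
    · refine Finset.sum_congr rfl fun e _ => ?_
      rcases mEdge H m.f e with _ | v <;> simp [elen]
  · refine Finset.sum_congr rfl fun e _ => ?_
    split_ifs <;> simp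

def ggdauxComp {d : ℕ} {G H I : EGraph d} (m : Matching d G H) (n : Matching d H I) :
    Matching d G I where
  f u := (m.f u).bind n.f
  g w := (n.g w).bind m.g
  f_mem := by
    intro u hu w h
    rw [Option.bind_eq_some_iff] at h
    obtain ⟨v, hv, hw⟩ := h
    exact n.f_mem v (m.f_mem u hu v hv) w hw
  g_mem := by
    intro u hu w h
    rw [Option.bind_eq_some_iff] at h
    obtain ⟨v, hv, hw⟩ := h
    exact m.g_mem v (n.g_mem u hu v hv) w hw
  consistent := by
    intro u hu w hw
    simp only [Option.bind_eq_some_iff]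
    constructor
    · rintro ⟨v, h1, h2⟩
      have hv := m.f_mem u hu v h1
      exact ⟨v, (n.consistent v hv w hw).1 h2, (m.consistent u hu v hv).1 h1⟩
    · rintro ⟨v, h1, h2⟩
      have hv := n.g_mem w hw v h1
      exact ⟨v, (m.consistent u hu v hv).2 h2, (n.consistent v hv w hw).2 h1⟩

theorem ggdaux_fwd {d : ℕ} (G H : GeoGraph d) (m : Matching d G.toEGraph H.toEGraph) :
    ∀ a ∈ G.edges, ∀ b, mEdge H.toEGraph m.f a = some b →
      b ∈ H.edges ∧ mEdge G.toEGraph m.g b = some a := by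
  intro a ha b h
  rw [ggdaux_mEdge] at h
  obtain ⟨h1, h2, h3⟩ := h
  refine ⟨h3, ?_⟩
  rw [ggdaux_mEdge]
  exact ⟨(m.consistent _ (G.edge_fst_mem a ha) _ (H.edge_fst_mem b h3)).1 h1,
    (m.consistent _ (G.edge_snd_mem a ha) _ (H.edge_snd_mem b h3)).1 h2, ha⟩

theorem ggdaux_bwd {d : ℕ} (G H : GeoGraph d) (m : Matching d G.toEGraph H.toEGraph) :
    ∀ b ∈ H.edges, ∀ a, mEdge G.toEGraph m.g b = some a →
      a ∈ G.edges ∧ mEdge H.toEGraph m.f a = some b := by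
  intro a ha b h
  rw [ggdaux_mEdge] at h
  obtain ⟨h1, h2, h3⟩ := h
  refine ⟨h3, ?_⟩
  rw [ggdaux_mEdge]
  exact ⟨(m.consistent _ (G.edge_fst_mem b h3) _ (H.edge_fst_mem a ha)).2 h1,
    (m.consistent _ (G.edge_snd_mem b h3) _ (H.edge_snd_mem a ha)).2 h2, ha⟩

theorem ggdaux_bind {d : ℕ} (T S : EGraph d) (φ ψ : Pt d → Option (Pt d)) (a b : Pt d × Pt d)
    (h : mEdge T φ a = some b) :
    mEdge S (fun u => (φ u).bind ψ) a = mEdge S ψ b := by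
  rw [ggdaux_mEdge] at h
  obtain ⟨h1, h2, -⟩ := h
  simp [mEdge, h1, h2]

theorem ggdaux_comp_le {d : ℕ} (CV CE : ℝ) (hCV : 0 < CV) (hCE : 0 < CE)
    (G H I : GeoGraph d) (m : Matching d G.toEGraph H.toEGraph)
    (n : Matching d H.toEGraph I.toEGraph) :
    matchCost CV CE (ggdauxComp m n) ≤ matchCost CV CE m + matchCost CV CE n := by
  have hE := ggdaux_edges (fun e : Pt d × Pt d => dist e.1 e.2) (fun _ => dist_nonneg)
    G.edges H.edges I.edges _ _ _ _ _ _ (ggdaux_fwd G H m) (ggdaux_bwd G H m)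
    (ggdaux_fwd H I n) (ggdaux_bwd H I n) (ggdaux_fwd G I (ggdauxComp m n))
    (fun a _ b h => ggdaux_bind _ _ _ _ a b h) (fun a _ b h => ggdaux_bind _ _ _ _ a b h)
  have hV : ∑ u ∈ G.verts, odist (some u) ((ggdauxComp m n).f u) ≤
      ∑ u ∈ G.verts, odist (some u) (m.f u) + ∑ v ∈ H.verts, odist (some v) (n.f v) := by
    have h1 := ggdaux_reidx G.verts H.verts m.f (fun v => odist (some v) (n.f v))
      (by intro b _; rcases n.f b with _ | c <;> simp [odist])
      m.f_mem
      (by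
        intro a ha a' ha' b h h'
        have hb := m.f_mem a ha b h
        have h1 := (m.consistent a ha b hb).1 h
        rw [(m.consistent a' ha' b hb).1 h'] at h1
        simpa using h1.symm)
    refine le_trans ?_ (add_le_add le_rfl h1)
    rw [← Finset.sum_add_distrib]
    refine Finset.sum_le_sum fun u _ => ?_
    show odist (some u) ((m.f u).bind n.f) ≤ _
    rcases m.f u with _ | v
    · simp [odist]
    · simp only [Option.bind_some, Option.elim_some]
      rcases n.f v with _ | w
      · simp [odist]
      · simpa [odist] using dist_triangle u v w
  rw [ggdaux_cost, ggdaux_cost, ggdaux_cost]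
  have h1 := mul_le_mul_of_nonneg_left hE hCE.le
  have h2 := mul_le_mul_of_nonneg_left hV hCV.le
  rw [mul_add] at h1 h2
  linarith

theorem ggdaux_nonneg {d : ℕ} (CV CE : ℝ) (hCV : 0 < CV) (hCE : 0 < CE)
    (G H : EGraph d) (m : Matching d G H) : 0 ≤ matchCost CV CE m := by
  rw [ggdaux_cost]
  refine add_nonneg (mul_nonneg hCV.le (Finset.sum_nonneg fun u _ => ?_))
    (mul_nonneg hCE.le (add_nonneg (Finset.sum_nonneg fun u _ => abs_nonneg _)
      (Finset.sum_nonneg fun u _ => ?_)))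
  · rcases m.f u with _ | v <;> simp [odist]
  · split_ifs
    · exact dist_nonneg
    · exact le_rfl

theorem ggdaux_nonempty {d : ℕ} (CV CE : ℝ) (G H : EGraph d) :
    {c : ℝ | ∃ m : Matching d G H, matchCost CV CE m = c}.Nonempty :=
  ⟨_, ⟨fun _ => none, fun _ => none, by simp, by simp, by simp⟩, rfl⟩

/-- For all geometric graphs `G`, `H`, `I` of `ℝ^d`,
`GGD(G,I) ≤ GGD(G,H) + GGD(H,I)`. -/
theorem ggd_triangle {d : ℕ} (CV CE : ℝ) (hCV : 0 < CV) (hCE : 0 < CE)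
    (G H I : GeoGraph d) :
    GGD CV CE G I ≤ GGD CV CE G H + GGD CV CE H I := by
  have key : GGD CV CE G I - GGD CV CE H I ≤ GGD CV CE G H := by
    refine le_csInf (ggdaux_nonempty CV CE _ _) ?_
    rintro x ⟨m, rfl⟩
    have : GGD CV CE G I - matchCost CV CE m ≤ GGD CV CE H I := by
      refine le_csInf (ggdaux_nonempty CV CE _ _) ?_
      rintro y ⟨n, rfl⟩
      have h1 : GGD CV CE G I ≤ matchCost CV CE (ggdauxComp m n) :=
        csInf_le ⟨0, by rintro _ ⟨k, rfl⟩; exact ggdaux_nonneg CV CE hCV hCE _ _ k⟩ ⟨_, rfl⟩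
      have := ggdaux_comp_le CV CE hCV hCE G H I m n
      linarith
    linarith
  linarith
end
end
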